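/- arXiv:1810.04473 — 2 statements merged into one kernel-verified Lean document; each statement's English description precedes it below -/
import Mathlib

section
/- Every connected subcubic graph G of girth at least 5 satisfies ν_ur(G) ≥ (n(G) − 2)/3. -/
open SimpleGraph

namespace URPaper

/-- `M` is a matching in the simple graph `G`: a finite set of edges of `G`
that are pairwise vertex-disjoint. -/
def IsMatchingSet {V : Type*} (G : SimpleGraph V) (M : Finset (Sym2 V)) : Prop :=
  (∀ e ∈ M, e ∈ G.edgeSet) ∧
    ∀ e ∈ M, ∀ f ∈ M, e ≠ f → ∀ v : V, v ∈ e → v ∉ f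

/-- The set of vertices covered by a set of edges. -/
def covered {V : Type*} (M : Finset (Sym2 V)) : Set V := {v | ∃ e ∈ M, v ∈ e}

/-- A matching `M` in `G` is uniquely restricted if no other matching of `G`
covers exactly the same set of vertices. -/
def IsURMatching {V : Type*} (G : SimpleGraph V) (M : Finset (Sym2 V)) : Prop :=
  IsMatchingSet G M ∧
    ∀ M' : Finset (Sym2 V), IsMatchingSet G M' → covered M' = covered M → M' = M

/-- The matching number `ν(G)`: the maximum size of a matching in `G`. -/
noncomputable def nu {V : Type*} (G : SimpleGraph V) : ℕ :=
  sSup {k | ∃ M : Finset (Sym2 V), IsMatchingSet G M ∧ M.card = k}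

/-- The uniquely restricted matching number `ν_ur(G)`: the maximum size of a
uniquely restricted matching in `G`. -/
noncomputable def nuUR {V : Type*} (G : SimpleGraph V) : ℕ :=
  sSup {k | ∃ M : Finset (Sym2 V), IsURMatching G M ∧ M.card = k}

/-- `D_G`: the set of vertices missed by at least one maximum matching of `G`. -/
def gallaiD {V : Type*} (G : SimpleGraph V) : Set V :=
  {v | ∃ M : Finset (Sym2 V), IsMatchingSet G M ∧ M.card = nu G ∧ v ∉ covered M}

/-- `A_G`: the set of vertices outside `D_G` having a neighbor in `D_G`. -/
def gallaiA {V : Type*} (G : SimpleGraph V) : Set V :=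
  {v | v ∉ gallaiD G ∧ ∃ u ∈ gallaiD G, G.Adj v u}

/-- `C_G = V(G) \ (A_G ∪ D_G)`. -/
def gallaiC {V : Type*} (G : SimpleGraph V) : Set V :=
  {v | v ∉ gallaiD G ∧ v ∉ gallaiA G}

/-- Membership in the family `𝒯`: trees `T` with `ν(T) = (n(T) - 1)/3`
(equivalently `3 ν(T) + 1 = n(T)`) such that every vertex of `A_T` has degree
at most `3` in `T`. -/
def MemT {V : Type*} (T : SimpleGraph V) : Prop :=
  T.IsTree ∧ (∀ v ∈ gallaiA T, (T.neighborSet v).ncard ≤ 3) ∧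
    3 * nu T + 1 = Nat.card V

/-- The graph obtained from `T` by contracting the set `S` to a single new
vertex (the vertex `none`), all other vertices being kept. -/
def contractSet {V : Type*} (T : SimpleGraph V) (S : Set V) :
    SimpleGraph (Option {x : V // x ∉ S}) where
  Adj a b :=
    match a, b with
    | some x, some y => T.Adj x y
    | some x, none => ∃ u ∈ S, T.Adj (x : V) u
    | none, some y => ∃ u ∈ S, T.Adj (y : V) u
    | none, none => False
  symm := by
    refine ⟨?_⟩
    rintro (_ | x) (_ | y) h
    · exact h
    · exact h
    · exact h
    · exact T.symm.symm _ _ h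
  loopless := by
    refine ⟨?_⟩
    rintro (_ | x) h
    · exact h
    · exact T.loopless.irrefl _ h

/-- The graph `BG1` from the paper, given by an explicit edge list. -/
def BG1 : SimpleGraph (Fin 10) :=
  SimpleGraph.fromEdgeSet {s(0,4), s(1,4), s(0,5), s(2,5), s(0,6), s(3,6), s(1,7), s(2,7), s(1,8), s(3,8), s(2,9), s(3,9)}

/-- The graph `BG2` from the paper, given by an explicit edge list. -/
def BG2 : SimpleGraph (Fin 13) :=
  SimpleGraph.fromEdgeSet {s(0,4), s(1,4), s(0,5), s(2,5), s(0,6), s(3,6), s(1,7), s(2,7), s(1,8), s(3,8), s(2,9), s(3,9), s(10,6), s(10,7), s(11,8), s(11,5), s(12,4), s(12,9)}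

/-- The graph `BG3` from the paper, given by an explicit edge list. -/
def BG3 : SimpleGraph (Fin 16) :=
  SimpleGraph.fromEdgeSet {s(0,1), s(1,2), s(2,3), s(3,4), s(4,5), s(5,0), s(6,7), s(7,8), s(8,9), s(9,10), s(10,11), s(11,6), s(12,0), s(12,6), s(13,2), s(13,8), s(14,4), s(14,10), s(15,12), s(15,13), s(15,14)}

/-- The graph `BG4` from the paper, given by an explicit edge list. -/
def BG4 : SimpleGraph (Fin 19) :=
  SimpleGraph.fromEdgeSet {s(0,1), s(1,2), s(2,3), s(3,4), s(4,5), s(5,0), s(6,7), s(7,8), s(8,9), s(9,10), s(10,11), s(11,6), s(12,0), s(13,1), s(14,2), s(15,3), s(16,4), s(17,5), s(12,6), s(13,7), s(14,8), s(15,9), s(16,10), s(17,11), s(18,12), s(18,14), s(18,16)}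

/-- The graph `BG5` from the paper, given by an explicit edge list. -/
def BG5 : SimpleGraph (Fin 16) :=
  SimpleGraph.fromEdgeSet {s(0,4), s(1,4), s(0,5), s(2,5), s(0,6), s(3,6), s(1,7), s(2,7), s(1,8), s(3,8), s(2,9), s(3,9), s(10,6), s(10,7), s(11,8), s(11,5), s(12,4), s(12,9), s(13,14), s(14,15), s(13,10), s(13,11), s(15,12)}

/-- The graph `BG6` from the paper, given by an explicit edge list. -/
def BG6 : SimpleGraph (Fin 19) :=
  SimpleGraph.fromEdgeSet {s(0,4), s(1,4), s(0,5), s(2,5), s(0,6), s(3,6), s(1,7), s(2,7), s(1,8), s(3,8), s(2,9), s(3,9), s(10,6), s(10,7), s(11,8), s(11,5), s(12,4), s(12,9), s(13,14), s(14,15), s(15,16), s(16,17), s(17,18), s(18,13), s(13,10), s(15,11), s(17,12)}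

/-- The graph `BG7` from the paper, given by an explicit edge list. -/
def BG7 : SimpleGraph (Fin 19) :=
  SimpleGraph.fromEdgeSet {s(0,1), s(1,2), s(2,3), s(3,4), s(4,5), s(5,0), s(6,7), s(7,8), s(8,9), s(9,10), s(10,11), s(11,6), s(12,0), s(12,6), s(13,2), s(13,8), s(14,4), s(14,10), s(15,12), s(15,13), s(15,14), s(17,16), s(16,18), s(17,9), s(17,5), s(18,3), s(18,11)}

/-- The graph `BG8` from the paper, given by an explicit edge list. -/
def BG8 : SimpleGraph (Fin 22) :=
  SimpleGraph.fromEdgeSet {s(0,1), s(1,2), s(2,3), s(3,4), s(4,5), s(5,0), s(6,7), s(7,8), s(8,9), s(9,10), s(10,11), s(11,6), s(12,0), s(13,1), s(14,2), s(15,3), s(16,4), s(17,5), s(12,6), s(13,7), s(14,8), s(15,9), s(16,10), s(17,11), s(18,12), s(18,14), s(18,16), s(19,20), s(20,21), s(19,13), s(19,15), s(21,17)}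

/-- The graph `BG9` from the paper, given by an explicit edge list. -/
def BG9 : SimpleGraph (Fin 25) :=
  SimpleGraph.fromEdgeSet {s(0,1), s(1,2), s(2,3), s(3,4), s(4,5), s(5,0), s(6,7), s(7,8), s(8,9), s(9,10), s(10,11), s(11,6), s(12,0), s(13,1), s(14,2), s(15,3), s(16,4), s(17,5), s(12,6), s(13,7), s(14,8), s(15,9), s(16,10), s(17,11), s(18,12), s(18,14), s(18,16), s(19,20), s(20,21), s(21,22), s(22,23), s(23,24), s(24,19), s(19,13), s(21,15), s(23,17)}

/-- The graph `GraphH1` from the paper, given by an explicit edge list. -/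
def GraphH1 : SimpleGraph (Fin 14) :=
  SimpleGraph.fromEdgeSet {s(0,4), s(1,4), s(0,5), s(2,5), s(0,6), s(3,6), s(1,7), s(2,7), s(1,8), s(3,8), s(2,9), s(3,9), s(10,6), s(10,7), s(11,8), s(11,5), s(12,4), s(12,9), s(13,10), s(13,11), s(13,12)}

/-- The graph `GraphH2` from the paper, given by an explicit edge list. -/
def GraphH2 : SimpleGraph (Fin 20) :=
  SimpleGraph.fromEdgeSet {s(0,1), s(1,2), s(2,3), s(3,4), s(4,5), s(5,0), s(6,7), s(7,8), s(8,9), s(9,10), s(10,11), s(11,6), s(12,0), s(13,1), s(14,2), s(15,3), s(16,4), s(17,5), s(12,6), s(13,7), s(14,8), s(15,9), s(16,10), s(17,11), s(18,12), s(18,14), s(18,16), s(19,13), s(19,15), s(19,17)}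

/-- Membership in the family `ℬ = {G₁, …, G₉}`, up to isomorphism. -/
def IsBlockB : ∀ (X : Type), SimpleGraph X → Prop := fun _ H =>
  Nonempty (H ≃g BG1) ∨ Nonempty (H ≃g BG2) ∨ Nonempty (H ≃g BG3) ∨
  Nonempty (H ≃g BG4) ∨ Nonempty (H ≃g BG5) ∨ Nonempty (H ≃g BG6) ∨
  Nonempty (H ≃g BG7) ∨ Nonempty (H ≃g BG8) ∨ Nonempty (H ≃g BG9)

/-- Membership in the family `ℬ_c = {G₁, G₂, G₃, G₄}`, up to isomorphism. -/
def IsBlockBc : ∀ (X : Type), SimpleGraph X → Prop := fun _ H =>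
  Nonempty (H ≃g BG1) ∨ Nonempty (H ≃g BG2) ∨ Nonempty (H ≃g BG3) ∨ Nonempty (H ≃g BG4)

/-- `G` (on vertex set `W`) arises from the tree `T` (on vertex set `V`) by
replacing every vertex of `S` by a graph from the family `𝓑`.  The map `π`
sends every vertex of `G` to the vertex of `T` it corresponds to:
* every fiber over a vertex outside `S` is a single vertex, and on these
  vertices `π` is an isomorphism with the corresponding induced subgraph of `T`;
* the fiber over a vertex `s ∈ S` induces a graph of the family `𝓑`;
* there are no edges between the fibers of two distinct vertices of `S`;
* for `s ∈ S` and `v ∉ S`, there is exactly one edge of `G` between the two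
  fibers if `sv ∈ E(T)` and none otherwise;
* each vertex of a fiber over `s ∈ S` has at most one neighbor outside this
  fiber (distinct attachment vertices), and a vertex of such a fiber having a
  neighbor outside the fiber has exactly two neighbors inside it
  (attachment only at vertices of degree `2` of the replacing graph). -/
def ArisesFrom (𝓑 : ∀ (X : Type), SimpleGraph X → Prop) {W V : Type}
    (G : SimpleGraph W) (T : SimpleGraph V) (S : Set V) (π : W → V) : Prop :=
  Function.Surjective π ∧
  (∀ v ∉ S, ∀ w w' : W, π w = v → π w' = v → w = w') ∧
  (∀ w w' : W, π w ∉ S → π w' ∉ S → (G.Adj w w' ↔ T.Adj (π w) (π w'))) ∧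
  (∀ s ∈ S, 𝓑 _ (G.induce (π ⁻¹' {s}))) ∧
  (∀ s ∈ S, ∀ s' ∈ S, s ≠ s' → ∀ w w' : W, π w = s → π w' = s' → ¬ G.Adj w w') ∧
  (∀ s ∈ S, ∀ v ∉ S, T.Adj s v →
    ∃! p : W × W, π p.1 = s ∧ π p.2 = v ∧ G.Adj p.1 p.2) ∧
  (∀ s ∈ S, ∀ v ∉ S, ¬ T.Adj s v →
    ∀ w w' : W, π w = s → π w' = v → ¬ G.Adj w w') ∧
  (∀ s ∈ S, ∀ w : W, π w = s → ∀ w₁ w₂ : W, π w₁ ≠ s → π w₂ ≠ s →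
    G.Adj w w₁ → G.Adj w w₂ → w₁ = w₂) ∧
  (∀ s ∈ S, ∀ w : W, π w = s → ∀ w' : W, π w' ≠ s → G.Adj w w' →
    (G.neighborSet w ∩ π ⁻¹' {s}).ncard = 2)

/-- Membership in the family `𝒢`: graphs arising from a tree `T ∈ 𝒯` by
replacing each vertex of a subset `S ⊆ D_T` by a graph of the family `ℬ`. -/
def InCalG {W : Type} (G : SimpleGraph W) : Prop :=
  ∃ (V : Type) (T : SimpleGraph V) (S : Set V) (π : W → V),
    Finite V ∧ MemT T ∧ S ⊆ gallaiD T ∧ ArisesFrom IsBlockB G T S π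

/-- `κ_G(P)`: the number of connected components of `G` whose induced graph
satisfies the (isomorphism invariant) predicate `P`. -/
noncomputable def kappa {W : Type} (G : SimpleGraph W)
    (P : ∀ (X : Type), SimpleGraph X → Prop) : ℕ :=
  Nat.card {c : G.ConnectedComponent // P _ (G.induce c.supp)}

/-- Membership in `𝒢₃`: cubic graphs of girth at least `5`. -/
def IsCubicGirth5 : ∀ (X : Type), SimpleGraph X → Prop := fun _ H =>
  (∀ v, (H.neighborSet v).ncard = 3) ∧ 5 ≤ H.egirth

/-- Being isomorphic to `H₁` or `H₂`. -/
def IsH1orH2 : ∀ (X : Type), SimpleGraph X → Prop := fun _ H =>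
  Nonempty (H ≃g GraphH1) ∨ Nonempty (H ≃g GraphH2)

section Helpers

set_option linter.unusedSectionVars false

open Classical in
/-- `f(S) ≤ k`: there is a uniquely restricted matching inside `S` with `|S| ≤ 3|M| + k`. -/
def FF {V : Type} (G : SimpleGraph V) (S : Finset V) (k : ℤ) : Prop :=
  ∃ M : Finset (Sym2 V), IsURMatching G M ∧ (∀ v ∈ covered M, v ∈ S) ∧
    (S.card : ℤ) ≤ 3 * M.card + k

variable {V : Type} [Fintype V] {G : SimpleGraph V}

lemma FF.mono {S : Finset V} {k l : ℤ} (h : FF G S k) (hkl : k ≤ l) : FF G S l := by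
  obtain ⟨M, h1, h2, h3⟩ := h
  exact ⟨M, h1, h2, by omega⟩

lemma FF.md {S : Finset V} {k : ℤ} (h : FF G S k) (hm : ((S.card : ℤ) - k) % 3 ≠ 0) :
    FF G S (k - 1) := by
  obtain ⟨M, h1, h2, h3⟩ := h
  exact ⟨M, h1, h2, by omega⟩

lemma FF.super {S T : Finset V} {k : ℤ} (h : FF G S k) (hST : S ⊆ T) :
    FF G T (k + T.card - S.card) := by
  obtain ⟨M, h1, h2, h3⟩ := h
  exact ⟨M, h1, fun v hv => hST (h2 v hv), by omega⟩

lemma ur_empty : IsURMatching G (∅ : Finset (Sym2 V)) := by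
  refine ⟨⟨by simp, by simp⟩, ?_⟩
  intro M' _ hc
  rw [Finset.eq_empty_iff_forall_notMem]
  intro e he
  induction e with
  | _ p q =>
    have : p ∈ covered M' := ⟨s(p, q), he, by simp⟩
    rw [hc] at this
    obtain ⟨e, he, _⟩ := this
    simp at he

lemma FF.zero (S : Finset V) : FF G S S.card :=
  ⟨∅, ur_empty, by rintro v ⟨e, he, _⟩; simp at he, by simp⟩

open Classical in
lemma cov_card {M : Finset (Sym2 V)} (hM : IsMatchingSet G M) :
    (Finset.univ.filter (· ∈ covered M)).card = 2 * M.card := by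
  have : (Finset.univ.filter (· ∈ covered M)) = M.biUnion Sym2.toFinset := by
    ext v
    simp only [Finset.mem_filter, Finset.mem_univ, true_and, Finset.mem_biUnion, Sym2.mem_toFinset]
    rfl
  rw [this, Finset.card_biUnion]
  · rw [Finset.sum_congr rfl (g := fun _ => 2)]
    · simp [mul_comm]
    · intro e he
      exact Sym2.card_toFinset_of_not_isDiag _ (G.not_isDiag_of_mem_edgeSet (hM.1 e he))
  · intro e he f hf hef
    refine Finset.disjoint_left.mpr ?_
    intro v hv hv'
    simp at hv hv'
    exact hM.2 e he f hf hef v hv hv'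

open Classical in
lemma split_cov {M : Finset (Sym2 V)} (hM : IsMatchingSet G M) {A B : Finset V} {a b : V}
    (hAB : Disjoint A B) (ha : a ∈ A) (hb : b ∈ B)
    (hc : ∀ p ∈ A, ∀ q ∈ B, G.Adj p q → p = a ∧ q = b)
    (hs : ∀ v ∈ covered M, v ∈ A ∨ v ∈ B) (v : V) :
    v ∈ covered (M.filter (fun e => ∀ x ∈ e, x ∈ A)) ↔
      v ∈ A ∧ v ∈ covered M ∧ ¬ (v = a ∧ s(a, b) ∈ M) := by
  rw [Finset.disjoint_left] at hAB
  constructor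
  · rintro ⟨e, he, hv⟩
    rw [Finset.mem_filter] at he
    refine ⟨he.2 v hv, ⟨e, he.1, hv⟩, ?_⟩
    rintro ⟨rfl, hab⟩
    by_cases h : e = s(v, b)
    · subst h
      exact hAB (he.2 b (by simp)) hb
    · exact hM.2 e he.1 _ hab h v hv (by simp)
  · rintro ⟨hvA, ⟨e, he, hv⟩, hn⟩
    refine ⟨e, ?_, hv⟩
    rw [Finset.mem_filter]
    refine ⟨he, ?_⟩
    obtain ⟨w, rfl⟩ := Sym2.mem_iff_exists.mp hv
    have hadj : G.Adj v w := hM.1 _ he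
    have hw := hs w ⟨_, he, by simp⟩
    rcases hw with hw | hw
    · intro x hx
      rcases Sym2.mem_iff.mp hx with rfl | rfl <;> assumption
    · obtain ⟨rfl, rfl⟩ := hc v hvA w hw hadj
      exact absurd ⟨rfl, he⟩ hn

lemma split_mem {M : Finset (Sym2 V)} (hM : IsMatchingSet G M) {A B : Finset V} {a b : V}
    (hc : ∀ p ∈ A, ∀ q ∈ B, G.Adj p q → p = a ∧ q = b)
    (hs : ∀ v ∈ covered M, v ∈ A ∨ v ∈ B) {e : Sym2 V} (he : e ∈ M) :
    (∀ x ∈ e, x ∈ A) ∨ (∀ x ∈ e, x ∈ B) ∨ e = s(a, b) := by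
  induction e with
  | _ p q =>
    have hadj : G.Adj p q := hM.1 _ he
    have hp := hs p ⟨_, he, by simp⟩
    have hq := hs q ⟨_, he, by simp⟩
    rcases hp with hp | hp <;> rcases hq with hq | hq
    · left; intro x hx
      rcases Sym2.mem_iff.mp hx with rfl | rfl <;> assumption
    · obtain ⟨rfl, rfl⟩ := hc p hp q hq hadj
      simp
    · obtain ⟨rfl, rfl⟩ := hc q hq p hp hadj.symm
      simp [Sym2.eq_swap]
    · right; left; intro x hx
      rcases Sym2.mem_iff.mp hx with rfl | rfl <;> assumption

lemma IsMatchingSet.sub {M N : Finset (Sym2 V)} (hM : IsMatchingSet G M) (h : N ⊆ M) :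
    IsMatchingSet G N :=
  ⟨fun e he => hM.1 e (h he), fun e he f hf => hM.2 e (h he) f (h hf)⟩

open Classical in
lemma cov_union (M N : Finset (Sym2 V)) (v : V) :
    v ∈ covered (M ∪ N) ↔ v ∈ covered M ∨ v ∈ covered N := by
  simp only [covered, Finset.mem_union, Set.mem_ofPred_eq]
  constructor
  · rintro ⟨e, h | h, hv⟩
    · exact Or.inl ⟨e, h, hv⟩
    · exact Or.inr ⟨e, h, hv⟩
  · rintro (⟨e, h, hv⟩ | ⟨e, h, hv⟩)
    · exact ⟨e, Or.inl h, hv⟩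
    · exact ⟨e, Or.inr h, hv⟩

open Classical in
lemma matching_union {M N : Finset (Sym2 V)} (hM : IsMatchingSet G M) (hN : IsMatchingSet G N)
    (h : ∀ v ∈ covered M, v ∉ covered N) : IsMatchingSet G (M ∪ N) ∧ Disjoint M N := by
  constructor
  · constructor
    · intro e he
      rcases Finset.mem_union.mp he with he | he
      · exact hM.1 e he
      · exact hN.1 e he
    · intro e he f hf hef v hv hv'
      rcases Finset.mem_union.mp he with he | he <;> rcases Finset.mem_union.mp hf with hf | hf
      · exact hM.2 e he f hf hef v hv hv'
      · exact h v ⟨e, he, hv⟩ ⟨f, hf, hv'⟩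
      · exact h v ⟨f, hf, hv'⟩ ⟨e, he, hv⟩
      · exact hN.2 e he f hf hef v hv hv'
  · rw [Finset.disjoint_left]
    intro e he he'
    induction e with
    | _ p q => exact h p ⟨_, he, by simp⟩ ⟨_, he', by simp⟩

open Classical in
lemma bridge1 {A B : Finset V} {a b : V} {k l : ℤ}
    (hAB : Disjoint A B) (ha : a ∈ A) (hb : b ∈ B)
    (hc : ∀ p ∈ A, ∀ q ∈ B, G.Adj p q → p = a ∧ q = b)
    (hA : FF G A k) (hB : FF G B l) : FF G (A ∪ B) (k + l) := by
  obtain ⟨M, hM, hMA, hMk⟩ := hA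
  obtain ⟨N, hN, hNB, hNl⟩ := hB
  have hd := Finset.disjoint_left.mp hAB
  obtain ⟨hU, hD⟩ := matching_union hM.1 hN.1 (fun v hv hv' => hd (hMA v hv) (hNB v hv'))
  refine ⟨M ∪ N, ⟨hU, ?_⟩, ?_, ?_⟩
  · intro M' hM' hcov
    have hcv : ∀ v, v ∈ covered M' ↔ v ∈ covered M ∨ v ∈ covered N := by
      intro v; rw [hcov, cov_union]
    have hs : ∀ v ∈ covered M', v ∈ A ∨ v ∈ B := by
      intro v hv
      exact ((hcv v).mp hv).imp (hMA v) (hNB v)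
    have h1 := split_cov hM' hAB ha hb hc hs
    have h2 := split_cov hM' hAB.symm hb ha
      (fun p hp q hq h => (hc q hq p hp h.symm).symm) (fun v hv => (hs v hv).symm)
    have m1 : IsMatchingSet G (M'.filter (fun e => ∀ x ∈ e, x ∈ A)) :=
      hM'.sub (Finset.filter_subset _ _)
    have m2 : IsMatchingSet G (M'.filter (fun e => ∀ x ∈ e, x ∈ B)) :=
      hM'.sub (Finset.filter_subset _ _)
    by_cases hab : s(a, b) ∈ M'
    · exfalso
      have haM : a ∈ covered M := by
        rcases (hcv a).mp ⟨_, hab, by simp⟩ with h | h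
        · exact h
        · exact absurd (hNB a h) (hd ha)
      have c1 := cov_card m1
      have c2 := cov_card hM.1
      have : (Finset.univ.filter (· ∈ covered (M'.filter (fun e => ∀ x ∈ e, x ∈ A)))) =
          (Finset.univ.filter (· ∈ covered M)).erase a := by
        ext v
        simp only [Finset.mem_filter, Finset.mem_univ, true_and, Finset.mem_erase]
        rw [h1, hcv]
        constructor
        · rintro ⟨hv, h | h, hn⟩
          · exact ⟨fun h' => hn ⟨h', hab⟩, h⟩
          · exact absurd (hNB v h) (hd hv)
        · rintro ⟨hn, h⟩
          exact ⟨hMA v h, Or.inl h, fun h' => hn h'.1⟩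
      rw [this, Finset.card_erase_of_mem (by simpa using haM)] at c1
      have : 0 < (Finset.univ.filter (· ∈ covered M)).card :=
        Finset.card_pos.mpr ⟨a, by simpa using haM⟩
      omega
    · have e1 := hM.2 _ m1 (by
        ext v
        rw [h1, hcv]
        constructor
        · rintro ⟨hv, h | h, hn⟩
          · exact h
          · exact absurd (hNB v h) (hd hv)
        · intro h
          exact ⟨hMA v h, Or.inl h, fun h' => hab h'.2⟩)
      have e2 := hN.2 _ m2 (by
        ext v
        rw [h2, hcv]
        constructor
        · rintro ⟨hv, h | h, hn⟩
          · exact absurd hv (hd (hMA v h))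
          · exact h
        · intro h
          exact ⟨hNB v h, Or.inr h, fun h' => hab (by rw [Sym2.eq_swap]; exact h'.2)⟩)
      ext e
      rw [Finset.mem_union, ← e1, ← e2, Finset.mem_filter, Finset.mem_filter]
      constructor
      · intro he
        rcases split_mem hM' hc hs he with h | h | h
        · exact Or.inl ⟨he, h⟩
        · exact Or.inr ⟨he, h⟩
        · exact absurd (h ▸ he) hab
      · rintro (h | h) <;> exact h.1
  · intro v hv
    rw [Finset.mem_union]
    exact ((cov_union _ _ _).mp hv).imp (hMA v) (hNB v)
  · rw [Finset.card_union_of_disjoint hAB, Finset.card_union_of_disjoint hD]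
    push_cast
    omega

open Classical in
lemma bridge2 {A B : Finset V} {a b : V} {k l : ℤ}
    (hAB : Disjoint A B) (ha : a ∈ A) (hb : b ∈ B) (hadj : G.Adj a b)
    (hc : ∀ p ∈ A, ∀ q ∈ B, G.Adj p q → p = a ∧ q = b)
    (hA : FF G (A.erase a) k) (hB : FF G (B.erase b) l) : FF G (A ∪ B) (k + l - 1) := by
  obtain ⟨M, hM, hMA', hMk⟩ := hA
  obtain ⟨N, hN, hNB', hNl⟩ := hB
  have hMA : ∀ v ∈ covered M, v ≠ a ∧ v ∈ A := fun v hv => Finset.mem_erase.mp (hMA' v hv)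
  have hNB : ∀ v ∈ covered N, v ≠ b ∧ v ∈ B := fun v hv => Finset.mem_erase.mp (hNB' v hv)
  have hd := Finset.disjoint_left.mp hAB
  obtain ⟨hU, hD⟩ := matching_union hM.1 hN.1 (fun v hv hv' => hd (hMA v hv).2 (hNB v hv').2)
  have hE : IsMatchingSet G {s(a, b)} := by
    constructor
    · intro e he
      rw [Finset.mem_singleton] at he
      subst he
      exact hadj
    · intro e he f hf hef
      rw [Finset.mem_singleton] at he hf
      exact absurd (he.trans hf.symm) hef
  have hEc : ∀ v, v ∈ covered ({s(a, b)} : Finset (Sym2 V)) ↔ v = a ∨ v = b := by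
    intro v; simp [covered]
  have haN : a ∉ covered N := fun h => hd ha (hNB a h).2
  have hbM : b ∉ covered M := fun h => hd (hMA b h).2 hb
  obtain ⟨hU2, hD2⟩ := matching_union hU hE (by
    intro v hv hv'
    rw [hEc] at hv'
    rw [cov_union] at hv
    rcases hv' with rfl | rfl
    · exact hv.elim (fun h => (hMA _ h).1 rfl) haN
    · exact hv.elim hbM (fun h => (hNB _ h).1 rfl))
  refine ⟨M ∪ N ∪ {s(a, b)}, ⟨hU2, ?_⟩, ?_, ?_⟩
  · intro M' hM' hcov
    have hcv : ∀ v, v ∈ covered M' ↔ (v ∈ covered M ∨ v ∈ covered N) ∨ v = a ∨ v = b := by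
      intro v; rw [hcov, cov_union, cov_union, hEc]
    have hs : ∀ v ∈ covered M', v ∈ A ∨ v ∈ B := by
      intro v hv
      rcases (hcv v).mp hv with (h | h) | rfl | rfl
      · exact Or.inl (hMA v h).2
      · exact Or.inr (hNB v h).2
      · exact Or.inl ha
      · exact Or.inr hb
    have h1 := split_cov hM' hAB ha hb hc hs
    have h2 := split_cov hM' hAB.symm hb ha
      (fun p hp q hq h => (hc q hq p hp h.symm).symm) (fun v hv => (hs v hv).symm)
    have m1 : IsMatchingSet G (M'.filter (fun e => ∀ x ∈ e, x ∈ A)) :=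
      hM'.sub (Finset.filter_subset _ _)
    have m2 : IsMatchingSet G (M'.filter (fun e => ∀ x ∈ e, x ∈ B)) :=
      hM'.sub (Finset.filter_subset _ _)
    by_cases hab : s(a, b) ∈ M'
    · have e1 := hM.2 _ m1 (by
        ext v
        rw [h1, hcv]
        constructor
        · rintro ⟨hv, (h | h) | rfl | rfl, hn⟩
          · exact h
          · exact absurd (hNB v h).2 (hd hv)
          · exact absurd ⟨rfl, hab⟩ hn
          · exact absurd hb (hd hv)
        · intro h
          exact ⟨(hMA v h).2, Or.inl (Or.inl h), fun h' => (hMA v h).1 h'.1⟩)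
      have e2 := hN.2 _ m2 (by
        ext v
        rw [h2, hcv]
        constructor
        · rintro ⟨hv, (h | h) | rfl | rfl, hn⟩
          · exact absurd hv (hd (hMA v h).2)
          · exact h
          · exact absurd hv (hd ha)
          · exact absurd ⟨rfl, by rw [Sym2.eq_swap]; exact hab⟩ hn
        · intro h
          exact ⟨(hNB v h).2, Or.inl (Or.inr h), fun h' => (hNB v h).1 h'.1⟩)
      ext e
      rw [Finset.mem_union, Finset.mem_union, ← e1, ← e2, Finset.mem_filter, Finset.mem_filter,
        Finset.mem_singleton]
      constructor
      · intro he
        rcases split_mem hM' hc hs he with h | h | h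
        · exact Or.inl (Or.inl ⟨he, h⟩)
        · exact Or.inl (Or.inr ⟨he, h⟩)
        · exact Or.inr h
      · rintro ((h | h) | rfl)
        · exact h.1
        · exact h.1
        · exact hab
    · exfalso
      have c1 := cov_card m1
      have c2 := cov_card hM.1
      have haM : a ∉ covered M := fun h => (hMA a h).1 rfl
      have : (Finset.univ.filter (· ∈ covered (M'.filter (fun e => ∀ x ∈ e, x ∈ A)))) =
          insert a (Finset.univ.filter (· ∈ covered M)) := by
        ext v
        simp only [Finset.mem_filter, Finset.mem_univ, true_and, Finset.mem_insert]
        rw [h1, hcv]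
        constructor
        · rintro ⟨hv, (h | h) | rfl | rfl, hn⟩
          · exact Or.inr h
          · exact absurd (hNB v h).2 (hd hv)
          · exact Or.inl rfl
          · exact absurd hb (hd hv)
        · rintro (rfl | h)
          · exact ⟨ha, Or.inr (Or.inl rfl), fun h' => hab h'.2⟩
          · exact ⟨(hMA v h).2, Or.inl (Or.inl h), fun h' => hab h'.2⟩
      rw [this, Finset.card_insert_of_notMem (by simpa using haM)] at c1
      omega
  · intro v hv
    rw [cov_union, cov_union, hEc] at hv
    rw [Finset.mem_union]
    rcases hv with (h | h) | rfl | rfl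
    · exact Or.inl (hMA v h).2
    · exact Or.inr (hNB v h).2
    · exact Or.inl ha
    · exact Or.inr hb
  · rw [Finset.card_union_of_disjoint hAB, Finset.card_union_of_disjoint hD2,
      Finset.card_union_of_disjoint hD]
    have := Finset.card_erase_add_one ha
    have := Finset.card_erase_add_one hb
    push_cast
    simp only [Finset.card_singleton]
    push_cast
    omega

open Classical in
/-- number of edges between two sets -/
noncomputable def ee {V : Type} (G : SimpleGraph V) (A B : Finset V) : ℕ :=
  ∑ a ∈ A, ∑ b ∈ B, if G.Adj a b then 1 else 0

lemma ee_comm (A B : Finset V) : ee G A B = ee G B A := by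
  unfold ee
  rw [Finset.sum_comm]
  refine Finset.sum_congr rfl fun b _ => Finset.sum_congr rfl fun a _ => ?_
  by_cases h : G.Adj a b
  · rw [if_pos h, if_pos h.symm]
  · rw [if_neg h, if_neg (fun h' => h h'.symm)]

lemma ee_mono {A A' B B' : Finset V} (h : A ⊆ A') (h' : B ⊆ B') : ee G A B ≤ ee G A' B' := by
  unfold ee
  refine le_trans (Finset.sum_le_sum_of_subset h) (Finset.sum_le_sum fun a _ => ?_)
  exact Finset.sum_le_sum_of_subset h'

open Classical in
lemma ee_le_left {A B C D : Finset V} (h : A ⊆ C ∪ D) : ee G A B ≤ ee G C B + ee G D B := by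
  refine le_trans (ee_mono h (Finset.Subset.refl B)) ?_
  unfold ee
  rw [← Finset.sum_union_inter]
  exact Nat.le_add_right _ _

open Classical in
lemma ee_le_right {A B C D : Finset V} (h : B ⊆ C ∪ D) : ee G A B ≤ ee G A C + ee G A D := by
  rw [ee_comm A B, ee_comm A C, ee_comm A D]
  exact ee_le_left h

lemma ee_ge_left {A B C D : Finset V} (hd : Disjoint C D) (hC : C ⊆ A) (hD : D ⊆ A) :
    ee G C B + ee G D B ≤ ee G A B := by
  classical
  refine le_trans ?_ (ee_mono (Finset.union_subset hC hD) (Finset.Subset.refl B))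
  unfold ee
  rw [Finset.sum_union hd]

lemma ee_ge_right {A B C D : Finset V} (hd : Disjoint C D) (hC : C ⊆ B) (hD : D ⊆ B) :
    ee G A C + ee G A D ≤ ee G A B := by
  rw [ee_comm A B, ee_comm A C, ee_comm A D]
  exact ee_ge_left hd hC hD

open Classical in
lemma ee_single (v : V) (S : Finset V) : ee G {v} S = (S.filter (G.Adj v)).card := by
  simp [ee]

lemma ee_self (v : V) : ee G {v} {v} = 0 := by
  simp [ee]

lemma ee_pos_adj {p q : V} (h : G.Adj p q) : ee G {p} {q} = 1 := by
  simp only [ee, Finset.sum_singleton]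
  rw [if_pos h]

lemma ee_le_one (p q : V) : ee G {p} {q} ≤ 1 := by
  simp only [ee, Finset.sum_singleton]
  split_ifs <;> simp

lemma ee_adj {p q : V} (h : 1 ≤ ee G {p} {q}) : G.Adj p q := by
  by_contra hn
  simp only [ee, Finset.sum_singleton] at h
  rw [if_neg hn] at h
  omega

lemma ee_empty_left (B : Finset V) : ee G ∅ B = 0 := by simp [ee]
lemma ee_empty_right (B : Finset V) : ee G B ∅ = 0 := by simp [ee]

lemma ee_exists_left {A B : Finset V} (h : 1 ≤ ee G A B) : ∃ a ∈ A, 1 ≤ ee G {a} B := by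
  by_contra hn
  push Not at hn
  have : ee G A B = 0 := by
    unfold ee
    refine Finset.sum_eq_zero fun a ha => ?_
    have := hn a ha
    simp only [ee, Finset.sum_singleton] at this
    omega
  omega

lemma ee_exists {A B : Finset V} (h : 1 ≤ ee G A B) : ∃ a ∈ A, ∃ b ∈ B, G.Adj a b := by
  obtain ⟨a, ha, h1⟩ := ee_exists_left h
  rw [ee_comm] at h1
  obtain ⟨b, hb, h2⟩ := ee_exists_left h1
  exact ⟨a, ha, b, hb, (ee_adj h2).symm⟩

lemma ee_uniq {A B : Finset V} {a b : V} (h : ee G A B ≤ 1) (ha : a ∈ A) (hb : b ∈ B)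
    (hab : G.Adj a b) : ∀ p ∈ A, ∀ q ∈ B, G.Adj p q → p = a ∧ q = b := by
  intro p hp q hq hpq
  have h1 := ee_pos_adj hab
  have h2 := ee_pos_adj hpq
  by_cases hpa : p = a
  · refine ⟨hpa, ?_⟩
    by_contra hqb
    subst hpa
    have := ee_ge_right (G := G) (A := {p}) (B := B) (C := {q}) (D := {b}) (by simpa using hqb)
      (by simpa using hq) (by simpa using hb)
    have := ee_mono (G := G) (A := {p}) (A' := A) (B := B) (B' := B) (by simpa using hp) (by simp)
    omega
  · exfalso
    have := ee_ge_left (G := G) (A := A) (B := B) (C := {p}) (D := {a}) (by simpa using hpa)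
      (by simpa using hp) (by simpa using ha)
    have := ee_mono (G := G) (A := {p}) (A' := {p}) (B := {q}) (B' := B) (by simp) (by simpa using hq)
    have := ee_mono (G := G) (A := {a}) (A' := {a}) (B := {b}) (B' := B) (by simp) (by simpa using hb)
    omega

open Classical in
/-- cut connectivity with parameter m -/
def Cn {V : Type} (G : SimpleGraph V) (m : ℕ) (U : Finset V) : Prop :=
  ∀ C ⊆ U, C.Nonempty → C ≠ U → m ≤ ee G C (U \ C)

/-- non-cubic -/
def NC {V : Type} (G : SimpleGraph V) (U : Finset V) : Prop := ∃ v ∈ U, ee G {v} U ≤ 2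

open Classical in
lemma bridge0 {A B : Finset V} {k l : ℤ}
    (hAB : Disjoint A B) (hA0 : A.Nonempty) (hB0 : B.Nonempty) (h : ee G A B ≤ 1)
    (hA : FF G A k) (hB : FF G B l) : FF G (A ∪ B) (k + l) := by
  by_cases h0 : ee G A B = 0
  · obtain ⟨a, ha⟩ := hA0
    obtain ⟨b, hb⟩ := hB0
    refine bridge1 hAB ha hb ?_ hA hB
    intro p hp q hq hpq
    exfalso
    have := ee_pos_adj hpq
    have := ee_mono (G := G) (A := {p}) (A' := A) (B := {q}) (B' := B)
      (by simpa using hp) (by simpa using hq)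
    omega
  · obtain ⟨a, ha, b, hb, hab⟩ := ee_exists (G := G) (A := A) (B := B) (by omega)
    exact bridge1 hAB ha hb (ee_uniq h ha hb hab) hA hB

open Classical in
lemma lemT (hdeg : ∀ (v : V) (S : Finset V), ee G {v} S ≤ 3) {U : Finset V}
    (IH : ∀ C, C ⊂ U → Cn G 1 C → NC G C → FF G C 1) {m : ℕ} (hm : 1 ≤ m) (hU : Cn G m U) :
    ∀ n : ℕ, ∀ T, T.card = n → T ⊆ U → T ≠ U → ∃ k : ℕ, m * k ≤ ee G T (U \ T) ∧ FF G T k := by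
  intro n
  induction n using Nat.strong_induction_on with
  | _ n ih =>
  intro T hn hTU hne
  by_cases hT0 : T.Nonempty
  swap
  · rw [Finset.not_nonempty_iff_eq_empty] at hT0
    subst hT0
    exact ⟨0, by simp, by simpa using FF.zero (G := G) (∅ : Finset V)⟩
  have hTm := hU T hTU hT0 hne
  by_cases hT : Cn G 1 T
  · refine ⟨1, by simpa using hTm, ?_⟩
    refine IH T (Finset.ssubset_iff_subset_ne.mpr ⟨hTU, hne⟩) hT ?_
    obtain ⟨v, hv, hv1⟩ := ee_exists_left (hm.trans hTm)
    refine ⟨v, hv, ?_⟩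
    have := ee_ge_right (G := G) (A := {v}) (B := U) (C := T) (D := U \ T)
      Finset.disjoint_sdiff hTU Finset.sdiff_subset
    have := hdeg v U
    omega
  · unfold Cn at hT
    push Not at hT
    obtain ⟨C, hCT, hC0, hCne, hC⟩ := hT
    have hss : C ⊂ T := Finset.ssubset_iff_subset_ne.mpr ⟨hCT, hCne⟩
    have hD0 : (T \ C).Nonempty := Finset.sdiff_nonempty.mpr hss.2
    have hDss : T \ C ⊂ T := Finset.sdiff_ssubset hCT hC0
    obtain ⟨k1, hk1, hF1⟩ := ih C.card (hn ▸ Finset.card_lt_card hss) C rfl (hCT.trans hTU)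
      (fun h => hss.2 (h ▸ hTU))
    obtain ⟨k2, hk2, hF2⟩ := ih (T \ C).card (hn ▸ Finset.card_lt_card hDss) (T \ C) rfl
      (hDss.1.trans hTU) (fun h => hDss.2 (h ▸ hTU))
    refine ⟨k1 + k2, ?_, ?_⟩
    · have i1 := ee_le_right (G := G) (A := C) (B := U \ C) (C := U \ T) (D := T \ C) (by
        intro x; simp; tauto)
      have i2 := ee_le_right (G := G) (A := T \ C) (B := U \ (T \ C)) (C := U \ T) (D := C) (by
        intro x; simp; tauto)
      have i3 := ee_ge_left (G := G) (A := T) (B := U \ T) (C := C) (D := T \ C)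
        Finset.disjoint_sdiff hCT Finset.sdiff_subset
      have i4 := ee_comm (G := G) C (T \ C)
      rw [mul_add]
      omega
    · have := bridge0 Finset.disjoint_sdiff hC0 hD0 (by omega) hF1 hF2
      rw [Finset.union_sdiff_of_subset hCT] at this
      exact_mod_cast this

open Classical in
lemma lemT' (hdeg : ∀ (v : V) (S : Finset V), ee G {v} S ≤ 3) {U : Finset V}
    (IH : ∀ C, C ⊂ U → Cn G 1 C → NC G C → FF G C 1) {m : ℕ} (hm : 1 ≤ m) (hU : Cn G m U)
    {T : Finset V} (hT : T ⊆ U) (hne : T ≠ U) (k : ℕ) (h : ee G T (U \ T) < m * (k + 1)) :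
    FF G T k := by
  obtain ⟨j, hj, hF⟩ := lemT hdeg IH hm hU T.card T rfl hT hne
  refine hF.mono ?_
  have : j < k + 1 := by
    by_contra hc
    have := Nat.mul_le_mul_left m (not_lt.mp hc)
    omega
  omega

open Classical in
lemma bridgeCase (hdeg : ∀ (v : V) (S : Finset V), ee G {v} S ≤ 3) {U : Finset V}
    (IH : ∀ C, C ⊂ U → Cn G 1 C → NC G C → FF G C 1) (hU : Cn G 1 U) :
    FF G U 1 ∨ Cn G 2 U := by
  by_contra hcon
  push Not at hcon
  obtain ⟨hF, hn⟩ := hcon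
  unfold Cn at hn
  push Not at hn
  obtain ⟨A, hAU, hA0, hAne, hA⟩ := hn
  have hA1 := hU A hAU hA0 hAne
  have hss : A ⊂ U := Finset.ssubset_iff_subset_ne.mpr ⟨hAU, hAne⟩
  set B := U \ A with hB
  have hB0 : B.Nonempty := Finset.sdiff_nonempty.mpr hss.2
  have hBss : B ⊂ U := Finset.sdiff_ssubset hAU hA0
  have hBA : U \ B = A := by rw [hB]; exact Finset.sdiff_sdiff_eq_self hAU
  have hdis : Disjoint A B := Finset.disjoint_sdiff
  have hun : A ∪ B = U := Finset.union_sdiff_of_subset hAU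
  have FA : FF G A 1 := by
    have := lemT' hdeg IH le_rfl hU hAU hAne 1 (by omega)
    exact_mod_cast this
  have FB : FF G B 1 := by
    have := lemT' hdeg IH le_rfl hU hBss.1 hBss.ne 1 (by rw [hBA, ee_comm]; omega)
    exact_mod_cast this
  obtain ⟨a, ha, b, hb, hab⟩ := ee_exists hA1
  have cA : (A.card : ℤ) % 3 = 1 := by
    by_contra hc
    have h0 := FA.md (by omega)
    have := bridge0 hdis hA0 hB0 (by omega) h0 FB
    rw [hun] at this
    exact hF (this.mono (by omega))
  have cB : (B.card : ℤ) % 3 = 1 := by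
    by_contra hc
    have h0 := FB.md (by omega)
    have := bridge0 hdis hA0 hB0 (by omega) FA h0
    rw [hun] at this
    exact hF (this.mono (by omega))
  have key : ∀ (A B : Finset V), A ⊆ U → U \ A ⊆ B → ee G A B ≤ 1 → ∀ a ∈ A, ∀ b ∈ B, G.Adj a b →
      Disjoint A B → (A.card : ℤ) % 3 = 1 → FF G (A.erase a) 0 := by
    intro A B hAU hB hA a ha b hb hab hdis cA
    have i1 := ee_ge_right (G := G) (A := {a}) (B := A ∪ B) (C := A.erase a) (D := B)
      (hdis.mono_left (Finset.erase_subset _ _))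
      ((Finset.erase_subset _ _).trans Finset.subset_union_left) Finset.subset_union_right
    have i2 := hdeg a (A ∪ B)
    have i3 := ee_pos_adj hab
    have i4 := ee_mono (G := G) (A := {a}) (A' := {a}) (B := {b}) (B' := B) (by simp)
      (by simpa using hb)
    have i5 := ee_ge_left (G := G) (A := A) (B := B) (C := A.erase a) (D := {a})
      (by simp) (Finset.erase_subset _ _) (by simpa using ha)
    have i6 := ee_le_right (G := G) (A := A.erase a) (B := U \ (A.erase a)) (C := B) (D := {a}) (by
        intro x hx
        have := @hB x
        simp only [Finset.mem_sdiff, Finset.mem_erase, Finset.mem_union,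
          Finset.mem_singleton] at *
        tauto)
    have i7 := ee_comm (G := G) {a} (A.erase a)
    have hne : A.erase a ≠ U := by
      intro h
      have := hAU ha
      rw [← h] at this
      simp at this
    have F2 := lemT' hdeg IH le_rfl hU ((Finset.erase_subset a _).trans hAU) hne 2 (by omega)
    have c := Finset.card_erase_add_one ha
    have F1 := F2.md (by omega)
    have F0 := F1.md (by omega)
    exact F0.mono (by norm_num)
  have FAa := key A B hAU hB.symm.subset (by omega) a ha b hb hab hdis cA
  have FBb := key B A hBss.1 hBA.subset (by rw [ee_comm]; omega) b hb a ha hab.symm hdis.symm cB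
  have := bridge2 hdis ha hb hab (ee_uniq (by omega) ha hb hab) FAa FBb
  rw [hun] at this
  exact hF (this.mono (by omega))

open Classical in
lemma lemD (hdeg : ∀ (v : V) (S : Finset V), ee G {v} S ≤ 3) {U : Finset V}
    (IH : ∀ C, C ⊂ U → Cn G 1 C → NC G C → FF G C 1) (hU : Cn G 2 U)
    {T : Finset V} (hTU : T ⊆ U) (hne : T ≠ U) (h4 : ee G T (U \ T) ≤ 4) (hF : ¬ FF G T 1) :
    ∃ K L : Finset V, Disjoint K L ∧ K ∪ L = T ∧ ee G K L = 0 ∧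
      ee G K (U \ K) = 2 ∧ ee G L (U \ L) = 2 ∧ K.card % 3 = 1 ∧ L.card % 3 = 1 := by
  have hT0 : T.Nonempty := by
    by_contra h
    rw [Finset.not_nonempty_iff_eq_empty] at h
    subst h
    exact hF ((FF.zero _).mono (by simp))
  have hTm := hU T hTU hT0 hne
  have hT : ¬ Cn G 1 T := by
    intro hT
    apply hF
    refine IH T (Finset.ssubset_iff_subset_ne.mpr ⟨hTU, hne⟩) hT ?_
    obtain ⟨v, hv, hv1⟩ := ee_exists_left (one_le_two.trans hTm)
    refine ⟨v, hv, ?_⟩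
    have := ee_ge_right (G := G) (A := {v}) (B := U) (C := T) (D := U \ T)
      Finset.disjoint_sdiff hTU Finset.sdiff_subset
    have := hdeg v U
    omega
  unfold Cn at hT
  push Not at hT
  obtain ⟨C, hCT, hC0, hCne, hC⟩ := hT
  have hss : C ⊂ T := Finset.ssubset_iff_subset_ne.mpr ⟨hCT, hCne⟩
  have hD0 : (T \ C).Nonempty := Finset.sdiff_nonempty.mpr hss.2
  have hDss : T \ C ⊂ T := Finset.sdiff_ssubset hCT hC0
  have hCU : C ≠ U := fun h => hss.2 (h ▸ hTU)
  have hDU : T \ C ≠ U := fun h => hDss.2 (h ▸ hTU)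
  have i1 := ee_le_right (G := G) (A := C) (B := U \ C) (C := U \ T) (D := T \ C) (by
    intro x; simp; tauto)
  have i2 := ee_le_right (G := G) (A := T \ C) (B := U \ (T \ C)) (C := U \ T) (D := C) (by
    intro x; simp; tauto)
  have i3 := ee_ge_left (G := G) (A := T) (B := U \ T) (C := C) (D := T \ C)
    Finset.disjoint_sdiff hCT Finset.sdiff_subset
  have i4 := ee_comm (G := G) C (T \ C)
  have j1 := hU C (hCT.trans hTU) hC0 hCU
  have j2 := hU (T \ C) (hDss.1.trans hTU) hD0 hDU
  have F1 := lemT' hdeg IH one_le_two hU (hCT.trans hTU) hCU 1 (by omega)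
  have F2 := lemT' hdeg IH one_le_two hU (hDss.1.trans hTU) hDU 1 (by omega)
  refine ⟨C, T \ C, Finset.disjoint_sdiff, Finset.union_sdiff_of_subset hCT, by omega, by omega,
    by omega, ?_, ?_⟩
  · by_contra hc
    have h0 := F1.md (by omega)
    have := bridge0 Finset.disjoint_sdiff hC0 hD0 (by omega) h0 F2
    rw [Finset.union_sdiff_of_subset hCT] at this
    exact hF (this.mono (by norm_num))
  · by_contra hc
    have h0 := F2.md (by omega)
    have := bridge0 Finset.disjoint_sdiff hC0 hD0 (by omega) F1 h0
    rw [Finset.union_sdiff_of_subset hCT] at this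
    exact hF (this.mono (by norm_num))

open Classical in
lemma descend (hdeg : ∀ (v : V) (S : Finset V), ee G {v} S ≤ 3)
    (hC4 : ∀ p q r s : V, G.Adj p q → G.Adj q r → G.Adj r s → G.Adj s p → p ≠ r → q ≠ s → False)
    {U : Finset V}
    (IH : ∀ C, C ⊂ U → Cn G 1 C → NC G C → FF G C 1) (hU : Cn G 2 U) :
    ∀ n : ℕ, ∀ K : Finset V, K.card = n → K ⊆ U → K ≠ U → K.card ≠ 1 → ee G K (U \ K) = 2 →
      K.card % 3 = 1 → FF G U 1 := by
  intro n
  induction n using Nat.strong_induction_on with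
  | _ n ih =>
  intro K hn hKU hKne hK1 hK2 hK3
  obtain ⟨a, ha, ha1⟩ := ee_exists_left (G := G) (A := K) (B := U \ K) (by omega)
  have hKss : K ⊂ U := Finset.ssubset_iff_subset_ne.mpr ⟨hKU, hKne⟩
  have hcK := Finset.card_pos.mpr ⟨a, ha⟩
  have hca := Finset.card_erase_add_one ha
  -- edges of a
  have a1 := hdeg a U
  have a2 := ee_ge_right (G := G) (A := {a}) (B := U) (C := K.erase a) (D := U \ K)
    (Finset.disjoint_sdiff.mono_left (Finset.erase_subset _ _))
    ((Finset.erase_subset _ _).trans hKU) Finset.sdiff_subset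
  have a3 := ee_le_left (G := G) (A := K) (B := U \ K) (C := K.erase a) (D := {a}) (by
    intro x hx
    by_cases h : x = a <;> simp [h, hx])
  have a4 := ee_ge_left (G := G) (A := K) (B := U \ K) (C := K.erase a) (D := {a}) (by simp)
    (Finset.erase_subset _ _) (by simpa using ha)
  have a5 := hU (K.erase a) ((Finset.erase_subset _ _).trans hKU)
    (Finset.card_pos.mp (by omega))
    (fun h => by
      have := hKU ha
      rw [← h] at this
      simp at this)
  have a6 := ee_le_right (G := G) (A := K.erase a) (B := U \ K.erase a) (C := U \ K) (D := {a}) (by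
    intro x
    simp only [Finset.mem_sdiff, Finset.mem_erase, Finset.mem_union, Finset.mem_singleton]
    tauto)
  have a7 := ee_comm (G := G) {a} (K.erase a)
  obtain ⟨b, hb, hb1⟩ := ee_exists_left (G := G) (A := K.erase a) (B := U \ K) (by omega)
  have hba : b ≠ a := (Finset.mem_erase.mp hb).1
  have hbK : b ∈ K := (Finset.mem_erase.mp hb).2
  have hcb := Finset.card_erase_add_one hb
  rw [ee_comm] at hb1
  obtain ⟨y, hy, hby'⟩ := ee_exists_left hb1
  have hby : G.Adj b y := (ee_adj hby').symm
  rw [ee_comm] at hb1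
  set T := (K.erase a).erase b with hT
  have hTK : T ⊆ K := (Finset.erase_subset _ _).trans (Finset.erase_subset _ _)
  have hTU : T ⊆ U := hTK.trans hKU
  have hTne : T ≠ U := fun h => by
    have := hKU ha
    rw [← h] at this
    simp [hT] at this
  have b1 := hdeg b U
  have b2 := ee_ge_right (G := G) (A := {b}) (B := U) (C := T) (D := U \ K)
    (Finset.disjoint_sdiff.mono_left hTK) hTU Finset.sdiff_subset
  have b4 := ee_ge_left (G := G) (A := K.erase a) (B := U \ K) (C := T) (D := {b}) (by simp [hT])
    (Finset.erase_subset _ _) (by simpa using hb)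
  have b7 := ee_comm (G := G) {b} T
  have t1 := ee_le_right (G := G) (A := T) (B := U \ T) (C := U \ K) (D := {a} ∪ {b}) (by
    intro x
    simp only [hT, Finset.mem_sdiff, Finset.mem_erase, Finset.mem_union, Finset.mem_singleton]
    tauto)
  have t2 := ee_le_right (G := G) (A := T) (B := {a} ∪ {b}) (C := {a}) (D := {b}) (by simp)
  have t3 := ee_mono (G := G) (A := T) (A' := K.erase a) (B := {a}) (B' := {a})
    (Finset.erase_subset _ _) (by simp)
  have hT4 : ee G T (U \ T) ≤ 4 := by omega
  by_cases hF : FF G T 1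
  · have F0 := hF.md (by omega)
    have F1 := F0.md (by omega)
    set R := (U \ K).erase y with hR
    have hRsub : R ⊆ U \ K := Finset.erase_subset _ _
    have hRU : R ⊆ U := hRsub.trans Finset.sdiff_subset
    have hRne : R ≠ U := fun h => by
      have := hKU ha
      rw [← h] at this
      simp [hR, ha] at this
    have hyU : y ∈ U := (Finset.mem_sdiff.mp hy).1
    have r1 := ee_le_right (G := G) (A := R) (B := U \ R) (C := K) (D := {y}) (by
      intro x
      simp only [hR, Finset.mem_sdiff, Finset.mem_erase, Finset.mem_union, Finset.mem_singleton]
      tauto)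
    have r2 := ee_mono (G := G) (A := R) (A' := U \ K) (B := K) (B' := K) hRsub (by simp)
    have r3 := ee_comm (G := G) (U \ K) K
    have r4 := hdeg y U
    have r5 := ee_ge_right (G := G) (A := {y}) (B := U) (C := R) (D := {b}) (by
      simp [hR, hbK]) hRU (by simpa using hKU hbK)
    have r6 := ee_comm (G := G) {y} R
    have FR := lemT' hdeg IH one_le_two hU hRU hRne 2 (by omega)
    have hdis : Disjoint (K.erase a) (U \ K) :=
      Finset.disjoint_sdiff.mono_left (Finset.erase_subset _ _)
    have := bridge2 hdis hb hy hby (ee_uniq (by omega) hb hy hby) F1 FR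
    have hsub : K.erase a ∪ (U \ K) ⊆ U :=
      Finset.union_subset ((Finset.erase_subset _ _).trans hKU) Finset.sdiff_subset
    have F := this.super hsub
    refine F.mono ?_
    rw [Finset.card_union_of_disjoint hdis, Finset.card_sdiff_of_subset hKU]
    have := Finset.card_le_card hKU
    omega
  · obtain ⟨K1, K2, hd, hu, h0, e1, e2, m1, m2⟩ := lemD hdeg IH hU hTU hTne hT4 hF
    have hK1T : K1 ⊆ T := hu ▸ Finset.subset_union_left
    have hK2T : K2 ⊆ T := hu ▸ Finset.subset_union_right
    have hcT : T.card < n := by omega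
    by_cases c1 : K1.card = 1
    swap
    · exact ih K1.card ((Finset.card_le_card hK1T).trans_lt hcT) K1 rfl (hK1T.trans hTU)
        (fun h => hTne (Finset.Subset.antisymm hTU (h ▸ hK1T))) c1 e1 m1
    by_cases c2 : K2.card = 1
    swap
    · exact ih K2.card ((Finset.card_le_card hK2T).trans_lt hcT) K2 rfl (hK2T.trans hTU)
        (fun h => hTne (Finset.Subset.antisymm hTU (h ▸ hK2T))) c2 e2 m2
    exfalso
    have key : ∀ K1 K2 : Finset V, K1 ∪ K2 = T → ee G K1 K2 = 0 → ee G K1 (U \ K1) = 2 →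
        ∀ z, K1 = {z} → G.Adj z a ∧ G.Adj z b := by
      rintro K1 K2 hu h0 e1 z rfl
      have s1 := ee_le_right (G := G) (A := {z}) (B := U \ {z}) (C := (U \ K) ∪ K2)
        (D := {a} ∪ {b}) (by
          intro x
          have : x ∈ ({z} ∪ K2 : Finset V) ↔ x ∈ T := by rw [hu]
          simp only [hT, Finset.mem_sdiff, Finset.mem_erase, Finset.mem_union,
            Finset.mem_singleton] at this ⊢
          tauto)
      have s2 := ee_le_right (G := G) (A := {z}) (B := (U \ K) ∪ K2) (C := U \ K) (D := K2) (by simp)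
      have s3 := ee_le_right (G := G) (A := {z}) (B := {a} ∪ {b}) (C := {a}) (D := {b}) (by simp)
      have s4 := ee_mono (G := G) (A := {z}) (A' := T) (B := U \ K) (B' := U \ K)
        (hu ▸ Finset.subset_union_left) (by simp)
      have s5 := ee_le_one (G := G) z a
      have s6 := ee_le_one (G := G) z b
      exact ⟨ee_adj (by omega), ee_adj (by omega)⟩
    obtain ⟨z1, hz1⟩ := Finset.card_eq_one.mp c1
    obtain ⟨z2, hz2⟩ := Finset.card_eq_one.mp c2
    obtain ⟨p1, p2⟩ := key K1 K2 hu h0 e1 z1 hz1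
    obtain ⟨q1, q2⟩ := key K2 K1 (by rw [Finset.union_comm]; exact hu)
      (by rw [ee_comm]; exact h0) e2 z2 hz2
    refine hC4 a z1 b z2 p1.symm p2 q2.symm q1 hba.symm ?_
    rintro rfl
    rw [hz1, hz2] at hd
    simp at hd

open Classical in
lemma twoCase (hdeg : ∀ (v : V) (S : Finset V), ee G {v} S ≤ 3)
    (hC4 : ∀ p q r s : V, G.Adj p q → G.Adj q r → G.Adj r s → G.Adj s p → p ≠ r → q ≠ s → False)
    {U : Finset V}
    (IH : ∀ C, C ⊂ U → Cn G 1 C → NC G C → FF G C 1) (hU : Cn G 2 U) (hNC : NC G U) :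
    FF G U 1 := by
  obtain ⟨w, hw, hw2⟩ := hNC
  by_cases hUw : U = {w}
  · exact (FF.zero U).mono (by simp [hUw])
  have w1 := hU {w} (by simpa using hw) (by simp) (fun h => hUw h.symm)
  rw [ee_single] at w1
  obtain ⟨u, hu, v, hv, huv⟩ := Finset.one_lt_card.mp (show 1 < _ from w1)
  simp only [Finset.mem_filter, Finset.mem_sdiff, Finset.mem_singleton] at hu hv
  obtain ⟨⟨huU, huw⟩, hwu⟩ := hu
  obtain ⟨⟨hvU, hvw⟩, hwv⟩ := hv
  set T := ((U.erase w).erase u).erase v with hT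
  have c1 := Finset.card_erase_add_one hw
  have hu1 : u ∈ U.erase w := by simp [huU, huw]
  have c2 := Finset.card_erase_add_one hu1
  have hv1 : v ∈ (U.erase w).erase u := by simp [hvU, hvw, huv.symm]
  have c3 := Finset.card_erase_add_one hv1
  rw [← hT] at c3
  have hTU : T ⊆ U := by
    intro x; simp only [hT, Finset.mem_erase]; tauto
  have hTne : T ≠ U := fun h => by
    rw [← h] at hw
    simp [hT] at hw
  have puv : ({u} ∪ {v} : Finset V) ⊆ U := by
    intro x; simp only [Finset.mem_union, Finset.mem_singleton]
    rintro (rfl | rfl) <;> assumption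
  have x1 := ee_ge_right (G := G) (A := {w}) (B := U) (C := T) (D := {u} ∪ {v}) (by
    simp [hT]) hTU puv
  have x2 := ee_ge_right (G := G) (A := {w}) (B := {u} ∪ {v}) (C := {u}) (D := {v})
    (by simpa using huv) (by simp) (by simp)
  have x3 := ee_pos_adj hwu
  have x4 := ee_pos_adj hwv
  have hwT : ee G {w} T = 0 := by omega
  have y1 := ee_ge_right (G := G) (A := {u}) (B := U) (C := T) (D := {w}) (by
    simp [hT]) hTU (by simpa using hw)
  have y2 := ee_ge_right (G := G) (A := {v}) (B := U) (C := T) (D := {w}) (by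
    simp [hT]) hTU (by simpa using hw)
  have y3 := ee_pos_adj hwu.symm
  have y4 := ee_pos_adj hwv.symm
  have y5 := hdeg u U
  have y6 := hdeg v U
  have z1 := ee_le_right (G := G) (A := T) (B := U \ T) (C := {w}) (D := {u} ∪ {v}) (by
    intro x
    simp only [hT, Finset.mem_sdiff, Finset.mem_erase, Finset.mem_union, Finset.mem_singleton]
    tauto)
  have z2 := ee_le_right (G := G) (A := T) (B := {u} ∪ {v}) (C := {u}) (D := {v}) (by simp)
  have z3 := ee_comm (G := G) {w} T
  have z4 := ee_comm (G := G) {u} T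
  have z5 := ee_comm (G := G) {v} T
  have hT4 : ee G T (U \ T) ≤ 4 := by omega
  have step : ∀ k : ℤ, FF G T k → FF G U k := by
    intro k hk
    have huT : u ∉ T := by simp [hT]
    have hwT' : w ∉ T := by simp [hT]
    have hd : Disjoint ({w} : Finset V) (insert u T) := by
      simp [hwT', Ne.symm huw]
    have e1 := ee_le_right (G := G) (A := {w}) (B := insert u T) (C := T) (D := {u}) (by
      intro x; simp [or_comm])
    have F0 : FF G (({w} : Finset V).erase w) 0 := by
      simpa using FF.zero (G := G) (∅ : Finset V)
    have F1 : FF G ((insert u T).erase u) k := by rwa [Finset.erase_insert huT]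
    have := bridge2 hd (by simp) (by simp) hwu
      (ee_uniq (by have := ee_le_one (G := G) w u; omega) (by simp) (by simp) hwu) F0 F1
    have F := this.super (T := U) (by
      intro x; simp only [Finset.mem_union, Finset.mem_singleton, Finset.mem_insert]
      rintro (rfl | rfl | h)
      · exact hw
      · exact huU
      · exact hTU h)
    refine F.mono ?_
    rw [Finset.card_union_of_disjoint hd, Finset.card_insert_of_notMem huT]
    simp only [Finset.card_singleton]
    push_cast
    omega
  by_cases hF : FF G T 1
  · exact step 1 hF
  obtain ⟨K1, K2, hd, hun, h0, e1, e2, m1, m2⟩ := lemD hdeg IH hU hTU hTne hT4 hF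
  have hK1T : K1 ⊆ T := hun ▸ Finset.subset_union_left
  by_cases hc : K1.card = 1
  swap
  · exact descend hdeg hC4 IH hU K1.card K1 rfl (hK1T.trans hTU)
      (fun h => hTne (Finset.Subset.antisymm hTU (h ▸ hK1T))) hc e1 m1
  exfalso
  obtain ⟨z, rfl⟩ := Finset.card_eq_one.mp hc
  have hzT : z ∈ T := hK1T (by simp)
  have s1 := ee_le_right (G := G) (A := {z}) (B := U \ {z}) (C := {w} ∪ K2)
    (D := {u} ∪ {v}) (by
      intro x
      have : x ∈ ({z} ∪ K2 : Finset V) ↔ x ∈ T := by rw [hun]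
      simp only [hT, Finset.mem_sdiff, Finset.mem_erase, Finset.mem_union,
        Finset.mem_singleton] at this ⊢
      tauto)
  have s2 := ee_le_right (G := G) (A := {z}) (B := {w} ∪ K2) (C := {w}) (D := K2) (by simp)
  have s3 := ee_le_right (G := G) (A := {z}) (B := {u} ∪ {v}) (C := {u}) (D := {v}) (by simp)
  have s4 := ee_mono (G := G) (A := {z}) (A' := T) (B := {w}) (B' := {w}) hK1T (by simp)
  have s5 := ee_le_one (G := G) z u
  have s6 := ee_le_one (G := G) z v
  have p1 : G.Adj z u := ee_adj (by omega)
  have p2 : G.Adj z v := ee_adj (by omega)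
  refine hC4 w u z v hwu p1.symm p2 hwv.symm ?_ huv
  rintro rfl
  simp [hT] at hzT

open Classical in
lemma mainA (hdeg : ∀ (v : V) (S : Finset V), ee G {v} S ≤ 3)
    (hC4 : ∀ p q r s : V, G.Adj p q → G.Adj q r → G.Adj r s → G.Adj s p → p ≠ r → q ≠ s → False) :
    ∀ n : ℕ, ∀ U : Finset V, U.card = n → Cn G 1 U → NC G U → FF G U 1 := by
  intro n
  induction n using Nat.strong_induction_on with
  | _ n ih =>
  intro U hn hU hNC
  have IH : ∀ C, C ⊂ U → Cn G 1 C → NC G C → FF G C 1 :=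
    fun C hC => ih C.card (hn ▸ Finset.card_lt_card hC) C rfl
  rcases bridgeCase hdeg IH hU with h | h
  · exact h
  · exact twoCase hdeg hC4 IH h hNC

open Classical in
lemma mainB (hdeg : ∀ (v : V) (S : Finset V), ee G {v} S ≤ 3)
    (hC4 : ∀ p q r s : V, G.Adj p q → G.Adj q r → G.Adj r s → G.Adj s p → p ≠ r → q ≠ s → False)
    {U : Finset V} (hU : Cn G 1 U) : FF G U 2 := by
  have IH : ∀ C, C ⊂ U → Cn G 1 C → NC G C → FF G C 1 :=
    fun C _ => mainA hdeg hC4 C.card C rfl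
  rcases bridgeCase hdeg IH hU with h | h
  · exact h.mono (by norm_num)
  · by_cases hU0 : U.Nonempty
    · obtain ⟨v, hv⟩ := hU0
      have i1 := ee_mono (G := G) (A := U.erase v) (A' := U.erase v) (B := U \ U.erase v) (B' := {v})
        (by simp) (by
          intro x
          simp only [Finset.mem_sdiff, Finset.mem_erase, Finset.mem_singleton]
          tauto)
      have i2 := ee_comm (G := G) (U.erase v) {v}
      have i3 := hdeg v (U.erase v)
      have F := lemT' hdeg IH one_le_two h (Finset.erase_subset v U)
        (fun h => by rw [← h] at hv; simp at hv) 1 (by omega)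
      have F' := F.super (Finset.erase_subset v U)
      refine F'.mono ?_
      have := Finset.card_erase_add_one hv
      omega
    · rw [Finset.not_nonempty_iff_eq_empty] at hU0
      subst hU0
      exact (FF.zero _).mono (by simp)

lemma noC4 (hg : 5 ≤ G.egirth) (p q r s : V) (h1 : G.Adj p q) (h2 : G.Adj q r) (h3 : G.Adj r s)
    (h4 : G.Adj s p) (hpr : p ≠ r) (hqs : q ≠ s) : False := by
  have hc : (Walk.cons h1 (Walk.cons h2 (Walk.cons h3 (Walk.cons h4 Walk.nil)))).IsCycle := by
    rw [Walk.cons_isCycle_iff]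
    have := h1.ne; have := h2.ne; have := h3.ne; have := h4.ne
    simp [Walk.cons_isPath_iff, *, Ne.symm]
  have := le_egirth.mp hg _ _ hc
  simp at this
  norm_cast at this

open Classical in
lemma conn_cut (hconn : G.Connected) : Cn G 1 (Finset.univ : Finset V) := by
  intro C _ hC0 hCne
  obtain ⟨x, hx⟩ := hC0
  obtain ⟨y, hy⟩ : ∃ y, y ∉ C := by
    by_contra h
    push Not at h
    exact hCne (Finset.eq_univ_iff_forall.mpr h)
  obtain ⟨p⟩ := hconn.preconnected x y
  obtain ⟨d, hd, h1, h2⟩ := p.exists_boundary_dart (C : Set V) (by simpa using hx) (by simpa using hy)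
  have := ee_pos_adj d.adj
  have := ee_mono (G := G) (A := {d.fst}) (A' := C) (B := {d.snd}) (B' := Finset.univ \ C)
    (by simpa using h1) (by simpa using h2)
  omega

end Helpers

/-- Every connected subcubic graph `G` of girth at least `5`
satisfies `ν_ur(G) ≥ (n(G) - 2)/3`. -/
theorem statement1 {V : Type} [Fintype V] (G : SimpleGraph V)
    (hconn : G.Connected)
    (hsubcubic : ∀ v : V, (G.neighborSet v).ncard ≤ 3)
    (hgirth : 5 ≤ G.egirth) :
    ((Nat.card V : ℝ) - 2) / 3 ≤ nuUR G := by
  classical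
  have hdeg : ∀ (v : V) (S : Finset V), ee G {v} S ≤ 3 := by
    intro v S
    rw [ee_single]
    refine le_trans ?_ (hsubcubic v)
    rw [← Set.ncard_coe_finset]
    refine Set.ncard_le_ncard ?_ (Set.toFinite _)
    intro x hx
    exact (Finset.mem_filter.mp (Finset.mem_coe.mp hx)).2
  obtain ⟨M, hM, _, hk⟩ := mainB hdeg (noC4 hgirth) (conn_cut hconn)
  have hle : M.card ≤ nuUR G := by
    unfold nuUR
    refine le_csSup ?_ ⟨M, hM, rfl⟩
    refine ⟨Fintype.card (Sym2 V), ?_⟩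
    rintro k ⟨N, _, rfl⟩
    exact Finset.card_le_univ N
  rw [Finset.card_univ] at hk
  rw [Nat.card_eq_fintype_card]
  have h1 : ((Fintype.card V : ℤ) : ℝ) ≤ ((3 * M.card + 2 : ℤ) : ℝ) := by exact_mod_cast hk
  have h2 : (M.card : ℝ) ≤ nuUR G := by exact_mod_cast hle
  push_cast at h1
  linarith

end URPaper
end

section
/- Let T be a tree in 𝒯, let v₁, v₂ ∈ A_T with N_T(v₁) = {u₁,u₂,u₅} and N_T(v₂) = {u₃,u₄,u₅}, and let T′ be the tree obtained from T by contracting all six edges incident with v₁ or v₂ into one new vertex w; concretely, T′ has vertex set (V(T) \ {v₁,v₂,u₁,u₂,u₃,u₄,u₅}) ∪ {w}, two vertices of V(T) \ {v₁,v₂,u₁,u₂,u₃,u₄,u₅} are adjacent in T′ if and only if they are adjacent in T, and w is adjacent in T′ exactly to those vertices of V(T) \ {v₁,v₂,u₁,u₂,u₃,u₄,u₅} that are adjacent in T to some uᵢ. Then T′ ∈ 𝒯, D_{T′} = {w} ∪ (D_T \ {u₁,u₂,u₃,u₄,u₅}), and A_{T′} = A_T \ {v₁,v₂}. -/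
open SimpleGraph

namespace URPaper

theorem bdd_nu {V : Type*} [Finite V] (G : SimpleGraph V) :
    BddAbove {k | ∃ M : Finset (Sym2 V), IsMatchingSet G M ∧ M.card = k} := by
  have := Fintype.ofFinite V
  classical
  refine ⟨Fintype.card (Sym2 V), ?_⟩
  rintro k ⟨M, -, rfl⟩
  exact Finset.card_le_univ M

theorem le_nu {V : Type*} [Finite V] {G : SimpleGraph V} {M : Finset (Sym2 V)}
    (h : IsMatchingSet G M) : M.card ≤ nu G :=
  le_csSup (bdd_nu G) ⟨M, h, rfl⟩

theorem exists_max {V : Type*} [Finite V] (G : SimpleGraph V) :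
    ∃ M : Finset (Sym2 V), IsMatchingSet G M ∧ M.card = nu G := by
  refine Nat.sSup_mem (s := {k | ∃ M : Finset (Sym2 V), IsMatchingSet G M ∧ M.card = k})
    ⟨0, ∅, ?_, rfl⟩ (bdd_nu G)
  simp [IsMatchingSet]

/-- Finset vertex cover. -/
def IsCov {V : Type*} (G : SimpleGraph V) (X : Finset V) : Prop :=
  ∀ x y, G.Adj x y → x ∈ X ∨ y ∈ X

theorem exists_leaf {V : Type*} [Finite V] {G : SimpleGraph V} (hG : G.IsAcyclic)
    {x y : V} (hxy : G.Adj x y) : ∃ l p, G.Adj l p ∧ ∀ q, G.Adj l q → q = p := by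
  classical
  have := Fintype.ofFinite V
  let c := G.connectedComponentMk x
  have ht : (G.induce c.supp).IsTree := hG.isTree_connectedComponent c
  have hx : x ∈ c.supp := by simp [c]
  have hy : y ∈ c.supp := by
    simpa [c] using hxy.symm.reachable
  have : Nontrivial c.supp := ⟨⟨x, hx⟩, ⟨y, hy⟩, by simpa using hxy.ne⟩
  obtain ⟨v, hv⟩ := ht.exists_vert_degree_one_of_nontrivial
  rw [degree_eq_one_iff_existsUnique_adj] at hv
  obtain ⟨w, hw, hu⟩ := hv
  refine ⟨v, w, hw, fun q hq => ?_⟩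
  have hqs : q ∈ c.supp := by
    have h1 := v.2
    rw [ConnectedComponent.mem_supp_iff] at h1 ⊢
    rw [← h1]
    exact ConnectedComponent.sound hq.symm.reachable
  exact congrArg Subtype.val (hu ⟨q, hqs⟩ hq)

theorem forest_bound {V : Type*} [Fintype V] [DecidableEq V] {G : SimpleGraph V}
    [DecidableRel G.Adj] (hG : G.IsAcyclic)
    (C : Finset V) (hC : C.Nonempty) (F : Finset (Sym2 V)) (hF : ∀ e ∈ F, e ∈ G.edgeSet)
    (hFC : ∀ e ∈ F, ∀ v ∈ e, v ∈ C) : F.card + 1 ≤ C.card := by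
  classical
  have : Nonempty C := hC.to_subtype
  have h1 : (G.induce (C : Set V)).IsAcyclic := hG.induce _
  have : Nonempty (C : Set V) := hC.to_subtype
  obtain ⟨T, hle, -, hT⟩ := Connected.exists_isTree_le_of_le_of_isAcyclic
    (connected_top (V := (C : Set V))) le_top h1
  have h2 := hT.card_edgeFinset
  have h3 : Fintype.card (C : Set V) = C.card := by simp
  rw [h3] at h2
  have h4 : F ⊆ T.edgeFinset.image (Sym2.map Subtype.val) := by
    intro e he
    induction e with | _ a b
    have ha := hFC _ he a (by simp)
    have hb := hFC _ he b (by simp)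
    rw [Finset.mem_image]
    refine ⟨s(⟨a, ha⟩, ⟨b, hb⟩), ?_, by simp⟩
    rw [mem_edgeFinset, mem_edgeSet]
    exact hle (by simpa using hF _ he)
  have := (Finset.card_le_card h4).trans Finset.card_image_le
  omega

theorem del_matching {V : Type*} {G : SimpleGraph V} {p : V}
    {M : Finset (Sym2 V)} (hM : IsMatchingSet (G.deleteIncidenceSet p) M) :
    IsMatchingSet G M ∧ p ∉ covered M := by
  refine ⟨⟨fun e he => edgeSet_mono (G.deleteIncidenceSet_le p) (hM.1 e he), hM.2⟩, ?_⟩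
  rintro ⟨e, he, hp⟩
  have := hM.1 e he
  induction e with | _ a b
  rw [mem_edgeSet, deleteIncidenceSet_adj] at this
  simp at hp
  grind

theorem del_cov {V : Type*} [DecidableEq V] {G : SimpleGraph V} {p : V}
    {X : Finset V} (hX : IsCov (G.deleteIncidenceSet p) X) : IsCov G (insert p X) := by
  intro x y hxy
  by_cases hx : x = p
  · simp [hx]
  by_cases hy : y = p
  · simp [hy]
  have := hX x y (by rw [deleteIncidenceSet_adj]; exact ⟨hxy, hx, hy⟩)
  simp; tauto

theorem konig {V : Type*} [Finite V] (n : ℕ) : ∀ G : SimpleGraph V, G.IsAcyclic →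
    G.edgeSet.ncard ≤ n → ∃ X : Finset V, IsCov G X ∧ X.card ≤ nu G := by
  classical
  have := Fintype.ofFinite V
  induction n with
  | zero =>
    intro G hG hn
    refine ⟨∅, fun x y hxy => ?_, by simp⟩
    have h0 : G.edgeSet = ∅ := by
      rw [← Set.ncard_eq_zero (Set.toFinite _)]; omega
    have : s(x, y) ∈ G.edgeSet := hxy
    simp [h0] at this
  | succ n ih =>
    intro G hG hn
    by_cases hE : ∃ x y, G.Adj x y
    swap
    · exact ⟨∅, fun x y hxy => (hE ⟨x, y, hxy⟩).elim, by simp⟩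
    obtain ⟨x, y, hxy⟩ := hE
    obtain ⟨l, p, hlp, hu⟩ := exists_leaf hG hxy
    have hlt : (G.deleteIncidenceSet p).edgeSet.ncard < G.edgeSet.ncard := by
      refine Set.ncard_lt_ncard ⟨edgeSet_mono (G.deleteIncidenceSet_le p), fun h => ?_⟩
        (Set.toFinite _)
      have := h (show s(l, p) ∈ G.edgeSet from hlp)
      rw [mem_edgeSet, deleteIncidenceSet_adj] at this
      exact this.2.2 rfl
    obtain ⟨X, hX, hXc⟩ := ih _ (hG.anti (G.deleteIncidenceSet_le p)) (by omega)
    obtain ⟨M, hM, hMc⟩ := exists_max (G.deleteIncidenceSet p)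
    refine ⟨insert p X, del_cov hX, ?_⟩
    obtain ⟨hM1, hp⟩ := del_matching hM
    have hl : l ∉ covered M := by
      rintro ⟨e, he, hle⟩
      have h1 := hM1.1 e he
      obtain ⟨q, rfl⟩ := hle
      have := hu q h1
      subst this
      exact hp ⟨_, he, by simp⟩
    have hnot : s(l, p) ∉ M := fun h => hp ⟨_, h, by simp⟩
    have : IsMatchingSet G (insert s(l, p) M) := by
      refine ⟨?_, ?_⟩
      · intro e he
        rcases Finset.mem_insert.1 he with rfl | he
        · exact hlp
        · exact hM1.1 e he
      · intro e he f hf hef v hve hvf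
        rcases Finset.mem_insert.1 he with rfl | he1 <;> rcases Finset.mem_insert.1 hf with rfl | hf1
        · exact hef rfl
        · rcases Sym2.mem_iff.1 hve with rfl | rfl
          · exact hl ⟨f, hf1, hvf⟩
          · exact hp ⟨f, hf1, hvf⟩
        · rcases Sym2.mem_iff.1 hvf with rfl | rfl
          · exact hl ⟨e, he1, hve⟩
          · exact hp ⟨e, he1, hve⟩
        · exact hM1.2 e he1 f hf1 hef v hve hvf
    have h2 := le_nu this
    rw [Finset.card_insert_of_notMem hnot] at h2
    have := Finset.card_insert_le p X
    omega

/-- Each edge of a maximum matching has exactly one vertex in a small cover. -/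
theorem cov_max {V : Type*} [Finite V] {G : SimpleGraph V} {X : Finset V} (hX : IsCov G X)
    {M : Finset (Sym2 V)} (hM : IsMatchingSet G M) :
    ∃ f : Sym2 V → V, (∀ e ∈ M, f e ∈ e ∧ f e ∈ X) ∧ Set.InjOn f M ∧ M.card ≤ X.card := by
  have : ∀ e : Sym2 V, ∃ v, e ∈ M → v ∈ e ∧ v ∈ X := by
    intro e
    induction e with | _ a b
    by_cases he : s(a, b) ∈ M
    · rcases hX a b (hM.1 _ he) with h | h
      · exact ⟨a, fun _ => ⟨by simp, h⟩⟩
      · exact ⟨b, fun _ => ⟨by simp, h⟩⟩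
    · exact ⟨a, fun h => (he h).elim⟩
  choose f hf using this
  have hinj : Set.InjOn f M := by
    intro e he e' he' hee
    by_contra hne
    exact hM.2 e he e' he' hne (f e) (hf e he).1 (hee ▸ (hf e' he').1)
  exact ⟨f, hf, hinj, Finset.card_le_card_of_injOn f (fun e he => (hf e he).2) hinj⟩

theorem cov_cov {V : Type*} [Finite V] {G : SimpleGraph V} {X : Finset V} (hX : IsCov G X)
    {M : Finset (Sym2 V)} (hM : IsMatchingSet G M) (hc : X.card ≤ M.card) :
    (∀ x ∈ X, x ∈ covered M) ∧ ∀ e ∈ M, ∀ a ∈ e, ∀ b ∈ e, a ∈ X → b ∈ X → a = b := by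
  classical
  obtain ⟨f, hf, hinj, -⟩ := cov_max hX hM
  have himg : M.image f = X := by
    apply Finset.eq_of_subset_of_card_le
    · intro x hx
      obtain ⟨e, he, rfl⟩ := Finset.mem_image.1 hx
      exact (hf e he).2
    · rw [Finset.card_image_of_injOn hinj]; exact hc
  have key : ∀ e ∈ M, ∀ a ∈ e, a ∈ X → a = f e := by
    intro e he a ha hX
    rw [← himg] at hX
    obtain ⟨e', he', rfl⟩ := Finset.mem_image.1 hX
    by_cases h : e = e'
    · rw [h]
    · exact (hM.2 e he e' he' h _ ha (hf e' he').1).elim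
  refine ⟨fun x hx => ?_, fun e he a ha b hb haX hbX => ?_⟩
  · rw [← himg] at hx
    obtain ⟨e, he, rfl⟩ := Finset.mem_image.1 hx
    exact ⟨e, he, (hf e he).1⟩
  · rw [key e he a ha haX, key e he b hb hbX]

theorem cov_notD {V : Type*} [Finite V] {G : SimpleGraph V} {X : Finset V} (hX : IsCov G X)
    (hc : X.card ≤ nu G) {x : V} (hx : x ∈ X) : x ∉ gallaiD G := by
  rintro ⟨M, hM, hMc, hn⟩
  exact hn ((cov_cov hX hM (hMc ▸ hc)).1 x hx)

theorem notD_cov {V : Type*} [Finite V] {G : SimpleGraph V} (hG : G.IsAcyclic) {x : V}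
    (hx : x ∉ gallaiD G) : ∃ X : Finset V, IsCov G X ∧ X.card ≤ nu G ∧ x ∈ X := by
  classical
  obtain ⟨X, hX, hc⟩ := konig _ (G.deleteIncidenceSet x)
    (hG.anti (G.deleteIncidenceSet_le x)) le_rfl
  obtain ⟨M, hM, hMc⟩ := exists_max (G.deleteIncidenceSet x)
  obtain ⟨hM1, hp⟩ := del_matching hM
  refine ⟨insert x X, del_cov hX, ?_, by simp⟩
  have h1 := le_nu hM1
  have h2 : M.card ≠ nu G := fun h => hx ⟨M, hM1, h, hp⟩
  have := Finset.card_insert_le x X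
  omega

theorem inc_bound {V : Type*} [Fintype V] [DecidableEq V] {G : SimpleGraph V}
    [DecidableRel G.Adj] (Y : Finset V) (hY : ∀ y ∈ Y, (G.neighborSet y).ncard ≤ 3)
    (F : Finset (Sym2 V)) (hF : ∀ e ∈ F, e ∈ G.edgeSet ∧ ∃ y ∈ Y, y ∈ e) :
    F.card ≤ 3 * Y.card := by
  have h1 : F ⊆ Y.biUnion (fun y => G.incidenceFinset y) := by
    intro e he
    obtain ⟨h, y, hy, hye⟩ := hF e he
    rw [Finset.mem_biUnion]
    exact ⟨y, hy, by rw [mem_incidenceFinset]; exact ⟨h, hye⟩⟩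
  refine (Finset.card_le_card h1).trans ?_
  rw [mul_comm]
  refine Finset.card_biUnion_le_card_mul _ _ _ fun y hy => ?_
  rw [card_incidenceFinset_eq_degree]
  have := hY y hy
  rwa [Set.ncard_eq_toFinset_card', ← neighborFinset_def, card_neighborFinset_eq_degree] at this

theorem memT_forward {V : Type*} [Fintype V] {T : SimpleGraph V} (hT : MemT T)
    (A : Finset V) (hA : ∀ x, x ∈ A ↔ x ∈ gallaiA T) :
    (∀ x y, T.Adj x y → (x ∈ A ↔ y ∉ A)) ∧ Nat.card V = 3 * A.card + 1 := by
  classical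
  obtain ⟨htree, hdeg, hcard⟩ := hT
  have hac := htree.isAcyclic
  obtain ⟨X, hX, hXc⟩ := konig _ T hac le_rfl
  obtain ⟨M, hM, hMc⟩ := exists_max T
  have hE := htree.card_edgeFinset
  rw [← Nat.card_eq_fintype_card] at hE
  have hdegA : ∀ a ∈ A, (T.neighborSet a).ncard ≤ 3 := fun a ha => hdeg a ((hA a).1 ha)
  -- neighbours of D are in A
  have hDX : ∀ Y : Finset V, IsCov T Y → Y.card ≤ nu T → ∀ x ∈ gallaiD T, x ∉ Y :=
    fun Y h1 h2 x hx hxY => cov_notD h1 h2 hxY hx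
  have hDA : ∀ x y, x ∈ gallaiD T → T.Adj x y → y ∈ A := by
    intro x y hx hxy
    rw [hA]
    refine ⟨fun hy => ?_, x, hx, hxy.symm⟩
    rcases hX x y hxy with h | h
    · exact hDX X hX hXc x hx h
    · exact hDX X hX hXc y hy h
  have hAY : ∀ Y : Finset V, IsCov T Y → Y.card ≤ nu T → A ⊆ Y := by
    intro Y h1 h2 a ha
    obtain ⟨-, u, hu, hau⟩ := (hA a).1 ha
    rcases h1 a u hau with h | h
    · exact h
    · exact (hDX Y h1 h2 u hu h).elim
  have hAX := hAY X hX hXc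
  let C : Finset V := Finset.univ.filter (fun x => x ∉ gallaiD T ∧ x ∉ A)
  let B : Finset V := C.filter (fun x => x ∉ X)
  have hBcard : B.card ≤ (X \ A).card := by
    have hex : ∀ b : V, ∃ y, b ∈ B → s(b, y) ∈ M ∧ y ∈ X \ A := by
      intro b
      by_cases hb : b ∈ B
      swap
      · exact ⟨b, fun h => (hb h).elim⟩
      simp only [B, C, Finset.mem_filter, Finset.mem_univ, true_and] at hb
      obtain ⟨⟨hbD, hbA⟩, hbX⟩ := hb
      have hbc : b ∈ covered M := by
        by_contra h
        exact hbD ⟨M, hM, hMc, h⟩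
      obtain ⟨e, he, y, rfl⟩ := hbc
      refine ⟨y, fun _ => ⟨he, ?_⟩⟩
      rw [Finset.mem_sdiff]
      refine ⟨(hX b y (hM.1 _ he)).resolve_left hbX, fun hyA => ?_⟩
      obtain ⟨Y, hY, hYc, hbY⟩ := notD_cov hac hbD
      have := (cov_cov hY hM (hMc ▸ hYc)).2 _ he b (by simp) y (by simp) hbY
        (hAY Y hY hYc hyA)
      have hadj : T.Adj b y := hM.1 _ he
      exact hadj.ne this
    choose g hg using hex
    refine Finset.card_le_card_of_injOn g (fun b hb => (hg b hb).2) ?_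
    intro b hb b' hb' hgg
    by_contra hne
    have h1 := (hg b hb).1
    have h2 := (hg b' hb').1
    refine hM.2 _ h1 _ h2 ?_ (g b) (by simp) (by simp [hgg])
    intro h
    rw [hgg] at h
    exact hne (Sym2.congr_left.1 h)
  have hCcard : C.card ≤ 2 * (X \ A).card := by
    have h1 : C.card = (C.filter (fun x => x ∈ X)).card + B.card :=
      (Finset.card_filter_add_card_filter_not _).symm
    have h2 : (C.filter (fun x => x ∈ X)).card ≤ (X \ A).card := by
      apply Finset.card_le_card
      intro x hx
      simp only [C, Finset.mem_filter, Finset.mem_univ, true_and] at hx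
      simp [hx.2, hx.1.2]
    omega
  have hXA : (X \ A).card + A.card = X.card := Finset.card_sdiff_add_card_eq_card hAX
  -- edges
  let F1 := T.edgeFinset.filter (fun e => ∃ y ∈ A, y ∈ e)
  let F2 := T.edgeFinset.filter (fun e => ¬ ∃ y ∈ A, y ∈ e)
  have hF : F1.card + F2.card = T.edgeFinset.card := Finset.card_filter_add_card_filter_not _
  have hF1 : F1.card ≤ 3 * A.card := by
    apply inc_bound A hdegA
    intro e he
    simpa [F1] using he
  have hF2C : ∀ e ∈ F2, ∀ v ∈ e, v ∈ C := by
    intro e he v hv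
    simp only [F2, Finset.mem_filter, mem_edgeFinset] at he
    obtain ⟨y, rfl⟩ := hv
    have hadj : T.Adj v y := he.1
    simp only [C, Finset.mem_filter, Finset.mem_univ, true_and]
    exact ⟨fun h => he.2 ⟨y, hDA v y h hadj, by simp⟩, fun h => he.2 ⟨v, h, by simp⟩⟩
  have hCe : C = ∅ := by
    by_contra hne
    have := forest_bound hac C (Finset.nonempty_iff_ne_empty.2 hne) F2
      (fun e he => by simpa using (Finset.mem_filter.1 he).1) hF2C
    omega
  have hF2e : F2 = ∅ := by
    by_contra hne
    obtain ⟨e, he⟩ := Finset.nonempty_iff_ne_empty.2 hne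
    induction e with | _ a b
    have := hF2C _ he a (by simp)
    simp [hCe] at this
  have hF2c : F2.card = 0 := by simp [hF2e]
  have hAc : A.card = nu T := by omega
  have hcov : ∀ e ∈ T.edgeFinset, ∃ y ∈ A, y ∈ e := by
    intro e he
    by_contra h
    have : e ∈ F2 := Finset.mem_filter.2 ⟨he, h⟩
    simp [hF2e] at this
  refine ⟨?_, by omega⟩
  have hnotboth : ∀ x y, T.Adj x y → x ∈ A → y ∈ A → False := by
    intro x y hxy hx hy
    let K1 := T.edgeFinset.filter (fun e => ∃ z ∈ A.erase x, z ∈ e)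
    let K2 := T.edgeFinset.filter (fun e => ¬ ∃ z ∈ A.erase x, z ∈ e)
    have hK : K1.card + K2.card = T.edgeFinset.card := Finset.card_filter_add_card_filter_not _
    have hK1 : K1.card ≤ 3 * (A.erase x).card := by
      apply inc_bound (G := T) (A.erase x) (fun a ha => hdegA a (Finset.mem_of_mem_erase ha))
      intro e he
      have := Finset.mem_filter.1 he
      exact ⟨by simpa using this.1, this.2⟩
    have hK2 : insert s(x, y) K2 ⊆ T.incidenceFinset x := by
      intro e he
      rw [mem_incidenceFinset]
      rcases Finset.mem_insert.1 he with rfl | he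
      · exact ⟨hxy, by simp⟩
      · have h := Finset.mem_filter.1 he
        refine ⟨by simpa using h.1, ?_⟩
        obtain ⟨z, hz, hze⟩ := hcov e h.1
        by_cases hzx : z = x
        · exact hzx ▸ hze
        · exact (h.2 ⟨z, Finset.mem_erase.2 ⟨hzx, hz⟩, hze⟩).elim
    have hn : s(x, y) ∉ K2 := by
      intro h
      exact (Finset.mem_filter.1 h).2 ⟨y, Finset.mem_erase.2 ⟨hxy.ne', hy⟩, by simp⟩
    have h5 := Finset.card_le_card hK2
    rw [Finset.card_insert_of_notMem hn, card_incidenceFinset_eq_degree] at h5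
    have h6 := hdegA x hx
    rw [Set.ncard_eq_toFinset_card', ← neighborFinset_def, card_neighborFinset_eq_degree] at h6
    have h7 := Finset.card_erase_add_one hx
    omega
  intro x y hxy
  refine ⟨fun hx hy => hnotboth x y hxy hx hy, fun hy => ?_⟩
  obtain ⟨z, hz, hze⟩ := hcov s(x, y) (by simpa using hxy)
  rcases Sym2.mem_iff.1 hze with rfl | rfl
  · exact hz
  · exact (hy hz).elim

theorem memT_backward {V : Type*} [Fintype V] {G : SimpleGraph V} (hconn : G.Connected)
    (A : Finset V) (hbip : ∀ x y, G.Adj x y → (x ∈ A ↔ y ∉ A))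
    (hdeg : ∀ a ∈ A, (G.neighborSet a).ncard ≤ 3) (hcard : Nat.card V = 3 * A.card + 1) :
    MemT G ∧ (∀ x, x ∈ gallaiD G ↔ x ∉ A) ∧ (∀ x, x ∈ gallaiA G ↔ x ∈ A) := by
  classical
  have hcovA : IsCov G A := by
    intro x y hxy
    have := hbip x y hxy
    tauto
  have hEle : G.edgeFinset.card ≤ 3 * A.card := by
    apply inc_bound A hdeg
    intro e he
    refine ⟨by simpa using he, ?_⟩
    induction e with | _ a b
    rcases hcovA a b (by simpa using he) with h | h
    · exact ⟨a, h, by simp⟩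
    · exact ⟨b, h, by simp⟩
  have hEge := hconn.card_vert_le_card_edgeSet_add_one
  have hEcard : Nat.card G.edgeSet = G.edgeFinset.card := by
    rw [Nat.card_eq_fintype_card, card_edgeSet]
  have htree : G.IsTree := by
    rw [isTree_iff_connected_and_card]
    exact ⟨hconn, by omega⟩
  have hac := htree.isAcyclic
  have hU : ∀ X : Finset V, IsCov G X → X.card ≤ A.card → X = A := by
    intro X hX hXc
    let A1 := A \ X
    let X1 := X \ A
    let F1 := G.edgeFinset.filter (fun e => ∃ y ∈ A ∩ X, y ∈ e)
    let F2 := G.edgeFinset.filter (fun e => ¬ ∃ y ∈ A ∩ X, y ∈ e)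
    have hF : F1.card + F2.card = G.edgeFinset.card := Finset.card_filter_add_card_filter_not _
    have hF1 : F1.card ≤ 3 * (A ∩ X).card := by
      apply inc_bound (G := G) (A ∩ X) (fun a ha => hdeg a (Finset.mem_inter.1 ha).1)
      intro e he
      have := Finset.mem_filter.1 he
      exact ⟨by simpa using this.1, this.2⟩
    have hF2 : ∀ e ∈ F2, ∀ v ∈ e, v ∈ A1 ∪ X1 := by
      intro e he v hv
      have h := Finset.mem_filter.1 he
      obtain ⟨y, rfl⟩ := hv
      have hadj : G.Adj v y := by simpa using h.1
      have h1 := hbip v y hadj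
      have h2 := hX v y hadj
      have h3 : ¬ (v ∈ A ∩ X) := fun h3 => h.2 ⟨v, h3, by simp⟩
      have h4 : ¬ (y ∈ A ∩ X) := fun h3 => h.2 ⟨y, h3, by simp⟩
      simp only [Finset.mem_inter, Finset.mem_union, Finset.mem_sdiff, A1, X1] at *
      tauto
    have hc1 : A1.card + (A ∩ X).card = A.card := Finset.card_sdiff_add_card_inter _ _
    have hc2 : X1.card + (A ∩ X).card = X.card := by
      rw [Finset.inter_comm]; exact Finset.card_sdiff_add_card_inter _ _
    have hc3 := Finset.card_union_le A1 X1
    have hemp : A1 ∪ X1 = ∅ := by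
      by_contra hne
      have := forest_bound hac _ (Finset.nonempty_iff_ne_empty.2 hne) F2
        (fun e he => by simpa using (Finset.mem_filter.1 he).1) hF2
      omega
    ext x
    have : x ∉ A1 ∪ X1 := by simp [hemp]
    simp only [Finset.mem_union, Finset.mem_sdiff, A1, X1] at this
    tauto
  have hnule : nu G ≤ A.card := by
    obtain ⟨M, hM, hMc⟩ := exists_max G
    obtain ⟨_, _, _, h⟩ := cov_max hcovA hM
    omega
  have hnu : nu G = A.card := by
    obtain ⟨X, hX, hXc⟩ := konig _ G hac le_rfl
    have := hU X hX (hXc.trans hnule)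
    subst this
    omega
  have hD : ∀ x, x ∈ gallaiD G ↔ x ∉ A := by
    intro x
    refine ⟨fun hx hxA => cov_notD hcovA hnu.ge hxA hx, fun hx => ?_⟩
    by_contra hxD
    obtain ⟨X, hX, hXc, hxX⟩ := notD_cov hac hxD
    exact hx (hU X hX (hXc.trans hnule) ▸ hxX)
  have hA : ∀ x, x ∈ gallaiA G ↔ x ∈ A := by
    intro x
    constructor
    · rintro ⟨h, -⟩
      by_contra h2
      exact h ((hD x).2 h2)
    · intro hx
      refine ⟨fun h => (hD x).1 h hx, ?_⟩
      have hpos := Finset.card_pos.2 ⟨x, hx⟩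
      have : Nontrivial V := by
        rw [← Finite.one_lt_card_iff_nontrivial]; omega
      obtain ⟨u, hu⟩ := hconn.preconnected.exists_adj_of_nontrivial x
      exact ⟨u, (hD u).2 ((hbip x u hu).1 hx), hu⟩
  exact ⟨⟨htree, fun v hv => hdeg v ((hA v).1 hv), by omega⟩, hD, hA⟩

theorem contract_connected {V : Type*} {T : SimpleGraph V} (hT : T.Connected) (S : Set V)
    (hS : S.Nonempty) : (contractSet T S).Connected := by
  classical
  let φ : V → Option {x : V // x ∉ S} := fun x => if h : x ∈ S then none else some ⟨x, h⟩
  have h1 : ∀ x y, T.Adj x y → (contractSet T S).Reachable (φ x) (φ y) := by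
    intro x y hxy
    by_cases hx : x ∈ S <;> by_cases hy : y ∈ S <;> simp only [φ, hx, hy, dite_true, dite_false]
    · exact Reachable.refl _
    · exact Adj.reachable (show ∃ u ∈ S, T.Adj y u from ⟨x, hx, hxy.symm⟩)
    · exact Adj.reachable (show ∃ u ∈ S, T.Adj x u from ⟨y, hy, hxy⟩)
    · exact Adj.reachable (show T.Adj x y from hxy)
  have h2 : ∀ x y, T.Walk x y → (contractSet T S).Reachable (φ x) (φ y) := by
    intro x y w
    induction w with
    | nil => exact Reachable.refl _
    | cons h _ ih => exact (h1 _ _ h).trans ih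
  have hsurj : Function.Surjective φ := by
    rintro (_ | ⟨x, hx⟩)
    · obtain ⟨s, hs⟩ := hS
      exact ⟨s, by simp [φ, hs]⟩
    · exact ⟨x, by simp [φ, hx]⟩
  refine ⟨?_⟩
  intro a b
  obtain ⟨x, rfl⟩ := hsurj a
  obtain ⟨y, rfl⟩ := hsurj b
  obtain ⟨w⟩ := hT.preconnected x y
  exact h2 _ _ w

/-- Lemma 6 of the paper. Let `T ∈ 𝒯`, let `v₁, v₂ ∈ A_T`
with `N_T(v₁) = {u₁, u₂, u₅}` and `N_T(v₂) = {u₃, u₄, u₅}`, and let `T'` be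
obtained from `T` by contracting all six edges incident with `v₁` or `v₂` into
one new vertex `w` (the vertex `none` of
`contractSet T {v₁, v₂, u₁, u₂, u₃, u₄, u₅}`). Then `T' ∈ 𝒯`,
`D_{T'} = {w} ∪ (D_T \ {u₁, u₂, u₃, u₄, u₅})`, and `A_{T'} = A_T \ {v₁, v₂}`. -/
theorem statement11 {V : Type} [Fintype V] (T : SimpleGraph V) (hT : MemT T)
    (v₁ v₂ u₁ u₂ u₃ u₄ u₅ : V) (hv₁ : v₁ ∈ gallaiA T) (hv₂ : v₂ ∈ gallaiA T)
    (hnodup : ([v₁, v₂, u₁, u₂, u₃, u₄, u₅] : List V).Nodup)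
    (hN₁ : T.neighborSet v₁ = {u₁, u₂, u₅})
    (hN₂ : T.neighborSet v₂ = {u₃, u₄, u₅})
    (S : Set V) (hS : S = {v₁, v₂, u₁, u₂, u₃, u₄, u₅}) :
    MemT (contractSet T S) ∧
    gallaiD (contractSet T S) =
      insert none (some '' {x : {x : V // x ∉ S} |
        (x : V) ∈ gallaiD T ∧ (x : V) ∉ ({u₁, u₂, u₃, u₄, u₅} : Set V)}) ∧
    gallaiA (contractSet T S) =
      some '' {x : {x : V // x ∉ S} |
        (x : V) ∈ gallaiA T ∧ (x : V) ≠ v₁ ∧ (x : V) ≠ v₂} := by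
  classical
  obtain ⟨A, hA⟩ : ∃ A : Finset V, ∀ x, x ∈ A ↔ x ∈ gallaiA T :=
    ⟨(gallaiA T).toFinset, by simp⟩
  obtain ⟨hbip, hcard⟩ := memT_forward hT A hA
  have hdeg : ∀ a ∈ A, (T.neighborSet a).ncard ≤ 3 := fun a ha => hT.2.1 a ((hA a).1 ha)
  obtain ⟨-, hD, -⟩ := memT_backward hT.1.connected A hbip hdeg hcard
  have hv1A := (hA _).2 hv₁
  have hv2A := (hA _).2 hv₂
  have n1 : ∀ u, T.Adj v₁ u ↔ u = u₁ ∨ u = u₂ ∨ u = u₅ := by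
    intro u; rw [← mem_neighborSet, hN₁]; simp
  have n2 : ∀ u, T.Adj v₂ u ↔ u = u₃ ∨ u = u₄ ∨ u = u₅ := by
    intro u; rw [← mem_neighborSet, hN₂]; simp
  have hu1 : u₁ ∉ A := (hbip _ _ ((n1 u₁).2 (by simp))).1 hv1A
  have hu2 : u₂ ∉ A := (hbip _ _ ((n1 u₂).2 (by simp))).1 hv1A
  have hu5 : u₅ ∉ A := (hbip _ _ ((n1 u₅).2 (by simp))).1 hv1A
  have hu3 : u₃ ∉ A := (hbip _ _ ((n2 u₃).2 (by simp))).1 hv2A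
  have hu4 : u₄ ∉ A := (hbip _ _ ((n2 u₄).2 (by simp))).1 hv2A
  have hmS : ∀ x, x ∈ S ↔ x = v₁ ∨ x = v₂ ∨ x = u₁ ∨ x = u₂ ∨ x = u₃ ∨ x = u₄ ∨ x = u₅ := by
    intro x; rw [hS]; simp
  have hv12 : v₁ ≠ v₂ := by simp at hnodup; tauto
  let A' : Finset (Option {x : V // x ∉ S}) :=
    (A.subtype (fun x => x ∉ S)).map Function.Embedding.some
  have hA's : ∀ x : {x : V // x ∉ S}, some x ∈ A' ↔ (x : V) ∈ A := by
    intro x; simp [A']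
  have hA'n : none ∉ A' := by simp [A']
  have hA'c : A'.card + 2 = A.card := by
    have h1 : A'.card = (A \ {v₁, v₂}).card := by
      rw [Finset.card_map, Finset.card_subtype]
      congr 1
      ext x
      simp only [Finset.mem_filter, Finset.mem_sdiff, hmS, Finset.mem_insert, Finset.mem_singleton]
      constructor
      · tauto
      · rintro ⟨h, h'⟩
        refine ⟨h, ?_⟩
        rintro (rfl | rfl | rfl | rfl | rfl | rfl | rfl) <;> tauto
    have h2 := Finset.card_sdiff_add_card_eq_card (s := {v₁, v₂}) (t := A) (by
      intro x hx
      simp at hx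
      rcases hx with rfl | rfl <;> assumption)
    rw [Finset.card_pair hv12] at h2
    omega
  have hScard : S.ncard = 7 := by
    have : S = (([v₁, v₂, u₁, u₂, u₃, u₄, u₅] : List V).toFinset : Set V) := by
      rw [hS]; simp
    rw [this, Set.ncard_coe_finset, List.toFinset_card_of_nodup hnodup]
    rfl
  have hcard' : Nat.card (Option {x : V // x ∉ S}) = 3 * A'.card + 1 := by
    rw [Finite.card_option]
    have h1 := Set.ncard_add_ncard_compl S
    have h2 : Nat.card {x : V // x ∉ S} = Sᶜ.ncard := rfl
    omega
  have hSadj : ∀ x, x ∉ S → (∃ u ∈ S, T.Adj x u) → x ∈ A := by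
    rintro x hx ⟨u, hu, hxu⟩
    rw [hmS] at hu hx
    rcases hu with rfl | rfl | rfl | rfl | rfl | rfl | rfl
    · have := (n1 x).1 hxu.symm
      tauto
    · have := (n2 x).1 hxu.symm
      tauto
    all_goals exact (hbip _ _ hxu).2 (by assumption)
  have hbip' : ∀ x y, (contractSet T S).Adj x y → (x ∈ A' ↔ y ∉ A') := by
    rintro (_ | x) (_ | y) h
    · exact h.elim
    · have := hSadj y y.2 h
      simp only [hA'n, hA's, this]; tauto
    · have := hSadj x x.2 h
      simp only [hA'n, hA's, this]; tauto
    · simp only [hA's]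
      exact hbip _ _ h
  have hdeg' : ∀ a ∈ A', ((contractSet T S).neighborSet a).ncard ≤ 3 := by
    rintro (_ | a) ha
    · exact (hA'n ha).elim
    rw [hA's] at ha
    refine le_trans ?_ (hdeg a ha)
    let φ : V → Option {x : V // x ∉ S} := fun x => if h : x ∈ S then none else some ⟨x, h⟩
    have hsub : (contractSet T S).neighborSet (some a) ⊆ φ '' (T.neighborSet a) := by
      rintro (_ | y) hy
      · obtain ⟨u, hu, hau⟩ : ∃ u ∈ S, T.Adj a u := hy
        exact ⟨u, hau, by simp [φ, hu]⟩
      · exact ⟨y, hy, by simp [φ, y.2]⟩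
    exact (Set.ncard_le_ncard hsub (Set.toFinite _)).trans (Set.ncard_image_le (Set.toFinite _))
  obtain ⟨hM, hD', hA''⟩ := memT_backward
    (contract_connected hT.1.connected S ⟨v₁, (hmS _).2 (by simp)⟩) A' hbip' hdeg' hcard'
  refine ⟨hM, ?_, ?_⟩
  · ext x
    rw [hD']
    rcases x with _ | x
    · simp [hA'n]
    · have hx := x.2
      rw [hmS] at hx
      simp only [hA's, Set.mem_insert_iff, Set.mem_image, Set.mem_setOf_eq, Option.some.injEq,
        exists_eq_right, hD, Set.mem_singleton_iff, reduceCtorEq, false_or]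
      tauto
  · ext x
    rw [hA'']
    rcases x with _ | x
    · simp [hA'n]
    · have hx := x.2
      rw [hmS] at hx
      simp only [hA's, Set.mem_image, Set.mem_setOf_eq, Option.some.injEq,
        exists_eq_right, hA]
      tauto

end URPaper
end
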